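/- Let f ∈ Λ_p, 1<p<∞, β₁,β₂,r₁,r₂>0, δ₁,δ₂ ∈ (0,1/2). Then ω_{β₁,β₂}(f^{(r₁,r₂)},δ₁,δ₂)_p ≍ (∫₀^{δ₁}∫₀^{δ₂} t₁^{−2r₁−1} t₂^{−2r₂−1} ω_{r₁+β₁,r₂+β₂}(f,t₁,t₂)_p² dt₁ dt₂)^{1/2}, in the sense that either side is finite if and only if the other is, and then each is bounded by a constant multiple of the other with constants independent of f, δ₁, δ₂. -/

import Mathlib

open MeasureTheory Real
open scoped ENNReal

noncomputable section

/-- The `L_p` norm of a function of two variables over the period square `(0,2π]²`. -/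
def Lp2Norm (p : ℝ) (f : ℝ → ℝ → ℝ) : ℝ≥0∞ :=
  (∫⁻ x in Set.Ioc (0:ℝ) (2*π), ∫⁻ y in Set.Ioc (0:ℝ) (2*π),
      ENNReal.ofReal (|f x y| ^ p)) ^ (1/p)

/-- `f ∈ L_p^0(T²)`: measurable, `2π`-periodic in each variable, finite `L_p` norm,
and zero mean in each variable separately. -/
structure MemLp0 (p : ℝ) (f : ℝ → ℝ → ℝ) : Prop where
  meas : Measurable (Function.uncurry f)
  periodic_x : ∀ y, Function.Periodic (fun x => f x y) (2*π)
  periodic_y : ∀ x, Function.Periodic (f x) (2*π)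
  norm_ne_top : Lp2Norm p f ≠ ⊤
  mean_x : ∀ᵐ (y : ℝ) ∂volume, (∫ x in (0:ℝ)..(2*π), f x y) = 0
  mean_y : ∀ᵐ (x : ℝ) ∂volume, (∫ y in (0:ℝ)..(2*π), f x y) = 0

/-- Generalized (fractional) binomial coefficient `C(α,ν) = α(α-1)⋯(α-ν+1)/ν!`. -/
def fracBinom (α : ℝ) : ℕ → ℝ
  | 0 => 1
  | n+1 => fracBinom α n * (α - (n : ℝ)) / ((n : ℝ) + 1)

/-- Fractional difference of order `α` with step `h` in the first variable. -/
def diffX (α h : ℝ) (f : ℝ → ℝ → ℝ) : ℝ → ℝ → ℝ :=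
  fun x y => ∑' ν : ℕ, (-1 : ℝ) ^ ν * fracBinom α ν * f (x + (α - (ν : ℝ)) * h) y

/-- Fractional difference of order `α` with step `h` in the second variable. -/
def diffY (α h : ℝ) (f : ℝ → ℝ → ℝ) : ℝ → ℝ → ℝ :=
  fun x y => ∑' ν : ℕ, (-1 : ℝ) ^ ν * fracBinom α ν * f x (y + (α - (ν : ℝ)) * h)

/-- The mixed (fractional) modulus of smoothness `ω_{α₁,α₂}(f, δ₁, δ₂)_p`. -/
def mixedMod (p α₁ α₂ δ₁ δ₂ : ℝ) (f : ℝ → ℝ → ℝ) : ℝ≥0∞ :=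
  ⨆ (h₁ : ℝ) (_ : |h₁| ≤ δ₁) (h₂ : ℝ) (_ : |h₂| ≤ δ₂),
    Lp2Norm p (diffX α₁ h₁ (diffY α₂ h₂ f))

/-- Cosine-cosine Fourier coefficient `a_{n₁,n₂}` of `f`. -/
def fourierCC (f : ℝ → ℝ → ℝ) (n₁ n₂ : ℕ) : ℝ :=
  (1/π^2) * ∫ x in (0:ℝ)..(2*π), ∫ y in (0:ℝ)..(2*π),
    f x y * Real.cos ((n₁ : ℝ) * x) * Real.cos ((n₂ : ℝ) * y)

/-- Sine-cosine Fourier coefficient `b_{n₁,n₂}` of `f`. -/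
def fourierSC (f : ℝ → ℝ → ℝ) (n₁ n₂ : ℕ) : ℝ :=
  (1/π^2) * ∫ x in (0:ℝ)..(2*π), ∫ y in (0:ℝ)..(2*π),
    f x y * Real.sin ((n₁ : ℝ) * x) * Real.cos ((n₂ : ℝ) * y)

/-- Cosine-sine Fourier coefficient `c_{n₁,n₂}` of `f`. -/
def fourierCS (f : ℝ → ℝ → ℝ) (n₁ n₂ : ℕ) : ℝ :=
  (1/π^2) * ∫ x in (0:ℝ)..(2*π), ∫ y in (0:ℝ)..(2*π),
    f x y * Real.cos ((n₁ : ℝ) * x) * Real.sin ((n₂ : ℝ) * y)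

/-- Sine-sine Fourier coefficient `d_{n₁,n₂}` of `f`. -/
def fourierSS (f : ℝ → ℝ → ℝ) (n₁ n₂ : ℕ) : ℝ :=
  (1/π^2) * ∫ x in (0:ℝ)..(2*π), ∫ y in (0:ℝ)..(2*π),
    f x y * Real.sin ((n₁ : ℝ) * x) * Real.sin ((n₂ : ℝ) * y)

/-- The class `Λ_p`: `f ∈ L_p^0(T²)` with lacunary Fourier series
`Σ λ_{μ₁,μ₂} cos 2^{μ₁}x cos 2^{μ₂}y`. -/
def InLambdaClass (p : ℝ) (f : ℝ → ℝ → ℝ) (lam : ℕ → ℕ → ℝ) : Prop :=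
  MemLp0 p f ∧
  (∀ μ₁ μ₂ : ℕ, fourierCC f (2^μ₁) (2^μ₂) = lam μ₁ μ₂) ∧
  (∀ n₁ n₂ : ℕ, (¬ ∃ μ₁ μ₂ : ℕ, n₁ = 2^μ₁ ∧ n₂ = 2^μ₂) → fourierCC f n₁ n₂ = 0) ∧
  (∀ n₁ n₂ : ℕ, fourierSC f n₁ n₂ = 0 ∧ fourierCS f n₁ n₂ = 0 ∧ fourierSS f n₁ n₂ = 0)

/-- Complex Fourier coefficient of a (real-valued) function on `T²`. -/
def fourierCoefZ (f : ℝ → ℝ → ℝ) (m₁ m₂ : ℤ) : ℂ :=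
  (((2*π)^2)⁻¹ : ℝ) * ∫ x in (0:ℝ)..(2*π), ∫ y in (0:ℝ)..(2*π),
    (f x y : ℂ) * Complex.exp (-Complex.I * ((m₁ : ℂ) * (x : ℂ) + (m₂ : ℂ) * (y : ℂ)))

/-- `g` is the mixed Weyl derivative `f^{(ρ₁,ρ₂)}` of `f` (and `g ∈ L_p^0(T²)`):
the Fourier coefficients of `g` arise from those of `f` by multiplication
with `(i m₁)^{ρ₁} (i m₂)^{ρ₂}`. -/
def HasWeylDeriv (p ρ₁ ρ₂ : ℝ) (f g : ℝ → ℝ → ℝ) : Prop :=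
  MemLp0 p g ∧ ∀ m₁ m₂ : ℤ,
    fourierCoefZ g m₁ m₂ =
      (Complex.I * (m₁ : ℂ)) ^ (ρ₁ : ℂ) * (Complex.I * (m₂ : ℂ)) ^ (ρ₂ : ℂ) * fourierCoefZ f m₁ m₂

/-- `(∫₀^a ∫₀^b t₁^{-r₁s-1} t₂^{-r₂s-1} ω_{r₁+β₁,r₂+β₂}(f,t₁,t₂)_p^s dt₁ dt₂)^{1/s}`. -/
def derivMajorant (p β₁ β₂ r₁ r₂ s a b : ℝ) (f : ℝ → ℝ → ℝ) : ℝ≥0∞ :=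
  (∫⁻ t₁ in Set.Ioo (0:ℝ) a, ∫⁻ t₂ in Set.Ioo (0:ℝ) b,
      ENNReal.ofReal (t₁ ^ (-r₁*s-1) * t₂ ^ (-r₂*s-1)) *
        mixedMod p (r₁+β₁) (r₂+β₂) t₁ t₂ f ^ s) ^ (1/s)

/-- The number of ordered representations of an integer as a sum of `k` powers of two is bounded
in terms of `k` only. -/
lemma exists_card_sum_two_pow_le (k : ℕ) : ∃ B : ℕ, ∀ (N : ℕ) (T : Finset (Fin k → ℕ)),
    (∀ p ∈ T, ∑ i, 2 ^ p i = N) → T.card ≤ B := by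
  induction k with
  | zero => exact ⟨1, fun N T _ => Finset.card_le_one_of_subsingleton T⟩
  | succ k ih =>
    obtain ⟨B, hB⟩ := ih
    refine ⟨B * ((k + 1) * (k + 2)), fun N T hT => ?_⟩
    have hmax : ∀ p : Fin (k + 1) → ℕ, ∃ i, ∀ j, p j ≤ p i := fun p => Finite.exists_max p
    choose m hm using hmax
    have hlow : ∀ p ∈ T, p (m p) ≤ Nat.log 2 N := fun p hp => by
      refine Nat.le_log_of_pow_le (by norm_num) ?_
      rw [← hT p hp]
      exact Finset.single_le_sum (f := fun i => 2 ^ p i) (fun _ _ => Nat.zero_le _)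
        (Finset.mem_univ (m p))
    have hupp : ∀ p ∈ T, Nat.log 2 N < p (m p) + (k + 1) + 1 := fun p hp => by
      have h1 : N ≤ (k + 1) * 2 ^ p (m p) := by
        rw [← hT p hp]
        calc ∑ i, 2 ^ p i ≤ ∑ _i : Fin (k + 1), 2 ^ p (m p) :=
              Finset.sum_le_sum fun i _ => Nat.pow_le_pow_right (by norm_num) (hm p i)
          _ = _ := by simp
      have h2 : k + 1 < 2 ^ (k + 1) := Nat.lt_two_pow_self
      refine Nat.log_lt_of_lt_pow' (by omega) ?_
      calc N ≤ (k + 1) * 2 ^ p (m p) := h1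
        _ < 2 ^ (k + 1) * 2 ^ p (m p) := by gcongr
        _ ≤ 2 ^ (p (m p) + (k + 1) + 1) := by
          rw [← pow_add]; exact Nat.pow_le_pow_right (by norm_num) (by omega)
    have hmaps : ∀ p ∈ T, (m p, Nat.log 2 N - p (m p)) ∈
        (Finset.univ : Finset (Fin (k + 1))) ×ˢ Finset.range (k + 2) := fun p hp => by
      have := hupp p hp
      have := hlow p hp
      simp only [Finset.mem_product, Finset.mem_univ, true_and, Finset.mem_range]
      omega
    have := Finset.card_le_mul_card_image_of_maps_to hmaps B ?_
    · simpa using this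
    rintro ⟨i, d⟩ -
    set F := {p ∈ T | (m p, Nat.log 2 N - p (m p)) = (i, d)} with hF
    have hFi : ∀ p ∈ F, p i = Nat.log 2 N - d := fun p hp => by
      simp only [hF, Finset.mem_filter, Prod.mk.injEq] at hp
      obtain ⟨hpT, h1, h2⟩ := hp
      have := hlow p hpT
      rw [h1] at h2 this
      omega
    have hinj : Set.InjOn (fun p : Fin (k + 1) → ℕ => i.removeNth p) F := by
      intro p hp q hq hpq
      rw [← Fin.insertNth_self_removeNth i p, ← Fin.insertNth_self_removeNth i q]
      simp only at hpq
      rw [hpq, hFi p hp, hFi q hq]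
    rw [← Finset.card_image_of_injOn hinj]
    refine hB (N - 2 ^ (Nat.log 2 N - d)) _ ?_
    intro q hq
    obtain ⟨p, hp, rfl⟩ := Finset.mem_image.1 hq
    have h1 := hT p (Finset.mem_filter.1 hp).1
    rw [Fin.sum_univ_succAbove _ i, hFi p hp] at h1
    simp only [Fin.removeNth]
    omega

/-- Lebesgue measure on the period square `(0,2π]²`. -/
def periodSq : Measure (ℝ × ℝ) :=
  (volume.restrict (Set.Ioc (0:ℝ) (2*π))).prod (volume.restrict (Set.Ioc (0:ℝ) (2*π)))

instance : IsFiniteMeasure periodSq := by unfold periodSq; infer_instance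

/-- The character `(x, y) ↦ exp (i (k₁ x + k₂ y))`. -/
def char2 (k : ℤ × ℤ) (z : ℝ × ℝ) : ℂ :=
  Complex.exp (Complex.I * ((k.1 : ℂ) * (z.1 : ℂ) + (k.2 : ℂ) * (z.2 : ℂ)))

lemma continuous_char2 (k : ℤ × ℤ) : Continuous (char2 k) := by
  unfold char2; fun_prop

lemma norm_char2 (k : ℤ × ℤ) (z : ℝ × ℝ) : ‖char2 k z‖ = 1 := by
  have : Complex.I * ((k.1 : ℂ) * (z.1 : ℂ) + (k.2 : ℂ) * (z.2 : ℂ)) =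
      ((k.1 * z.1 + k.2 * z.2 : ℝ) : ℂ) * Complex.I := by push_cast; ring
  rw [char2, this, Complex.norm_exp_ofReal_mul_I]

lemma char2_zero (z : ℝ × ℝ) : char2 0 z = 1 := by simp [char2]

lemma char2_add (k l : ℤ × ℤ) (z : ℝ × ℝ) : char2 (k + l) z = char2 k z * char2 l z := by
  rw [char2, char2, char2, ← Complex.exp_add]
  congr 1; simp; ring

lemma conj_char2 (k : ℤ × ℤ) (z : ℝ × ℝ) : (starRingEnd ℂ) (char2 k z) = char2 (-k) z := by
  rw [char2, char2, ← Complex.exp_conj]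
  congr 1; simp; ring

lemma char2_sum {ι : Type*} (s : Finset ι) (p : ι → ℤ × ℤ) (z : ℝ × ℝ) :
    char2 (∑ i ∈ s, p i) z = ∏ i ∈ s, char2 (p i) z := by
  classical
  induction s using Finset.induction_on with
  | empty => simp [char2_zero]
  | insert a s ha ih => rw [Finset.sum_insert ha, Finset.prod_insert ha, char2_add, ih]

lemma integrable_mul_char2 {F : ℝ × ℝ → ℂ} (hF : Integrable F periodSq) (k : ℤ × ℤ) :
    Integrable (fun z => F z * char2 k z) periodSq := by
  refine hF.mul_bdd (c := 1) (continuous_char2 k).aestronglyMeasurable ?_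
  exact Filter.Eventually.of_forall fun z => (norm_char2 k z).le

lemma integrable_char2 (k : ℤ × ℤ) : Integrable (char2 k) periodSq := by
  simpa using integrable_mul_char2 (integrable_const (1:ℂ)) k

lemma integral_exp_int (m : ℤ) :
    ∫ x in Set.Ioc (0:ℝ) (2*π), Complex.exp (Complex.I * ((m : ℂ) * (x : ℂ))) =
      if m = 0 then (2*π : ℂ) else 0 := by
  rw [← intervalIntegral.integral_of_le (by positivity)]
  split_ifs with h
  · simp [h]
  · have hc : Complex.I * (m : ℂ) ≠ 0 := by simp [h]
    have := integral_exp_mul_complex (a := 0) (b := 2*π) hc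
    simp only [← mul_assoc]
    rw [this]
    have h2 : Complex.exp (Complex.I * m * ((2 * π : ℝ) : ℂ)) = 1 := by
      rw [Complex.exp_eq_one_iff]; exact ⟨m, by push_cast; ring⟩
    rw [h2]; simp

lemma integral_char2 (k : ℤ × ℤ) :
    ∫ z, char2 k z ∂periodSq = if k = 0 then ((2*π)^2 : ℂ) else 0 := by
  have : ∀ z : ℝ × ℝ, char2 k z = Complex.exp (Complex.I * ((k.1 : ℂ) * (z.1 : ℂ))) *
      Complex.exp (Complex.I * ((k.2 : ℂ) * (z.2 : ℂ))) := fun z => by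
    rw [char2, ← Complex.exp_add]; congr 1; ring
  simp_rw [this]
  rw [periodSq, integral_prod_mul (fun x : ℝ => Complex.exp (Complex.I * ((k.1 : ℂ) * (x : ℂ))))
    (fun y : ℝ => Complex.exp (Complex.I * ((k.2 : ℂ) * (y : ℂ)))),
    integral_exp_int, integral_exp_int]
  rcases k with ⟨a, b⟩
  by_cases ha : a = 0 <;> by_cases hb : b = 0 <;> simp [ha, hb, sq]

/-- The trigonometric polynomial with coefficients `c` on the finite set `S` of frequencies. -/
def trigPoly (S : Finset (ℤ × ℤ)) (c : ℤ × ℤ → ℂ) (z : ℝ × ℝ) : ℂ := ∑ k ∈ S, c k * char2 k z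

lemma continuous_trigPoly (S : Finset (ℤ × ℤ)) (c : ℤ × ℤ → ℂ) : Continuous (trigPoly S c) := by
  unfold trigPoly
  exact continuous_finsetSum _ fun k _ => continuous_const.mul (continuous_char2 k)

lemma norm_trigPoly_le (S : Finset (ℤ × ℤ)) (c : ℤ × ℤ → ℂ) (z : ℝ × ℝ) :
    ‖trigPoly S c z‖ ≤ ∑ k ∈ S, ‖c k‖ := by
  refine (norm_sum_le _ _).trans (Finset.sum_le_sum fun k _ => ?_)
  rw [norm_mul, norm_char2, mul_one]

lemma memLp_trigPoly (S : Finset (ℤ × ℤ)) (c : ℤ × ℤ → ℂ) (q : ℝ≥0∞) :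
    MemLp (trigPoly S c) q periodSq :=
  MemLp.of_bound (continuous_trigPoly S c).aestronglyMeasurable (∑ k ∈ S, ‖c k‖)
    (Filter.Eventually.of_forall (norm_trigPoly_le S c))

lemma integral_mul_conj_trigPoly {F : ℝ × ℝ → ℂ} (hF : Integrable F periodSq)
    (S : Finset (ℤ × ℤ)) (c : ℤ × ℤ → ℂ) :
    ∫ z, F z * (starRingEnd ℂ) (trigPoly S c z) ∂periodSq =
      ∑ k ∈ S, (starRingEnd ℂ) (c k) * ∫ z, F z * char2 (-k) z ∂periodSq := by
  have : ∀ z, F z * (starRingEnd ℂ) (trigPoly S c z) =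
      ∑ k ∈ S, (starRingEnd ℂ) (c k) * (F z * char2 (-k) z) := fun z => by
    rw [trigPoly, map_sum, Finset.mul_sum]
    refine Finset.sum_congr rfl fun k _ => ?_
    rw [map_mul, conj_char2]; ring
  simp_rw [this]
  rw [integral_finsetSum _ fun k _ => (integrable_mul_char2 hF _).const_mul _]
  simp_rw [integral_const_mul]

lemma integral_trigPoly_mul_char2 (S : Finset (ℤ × ℤ)) (c : ℤ × ℤ → ℂ) (l : ℤ × ℤ) :
    ∫ z, trigPoly S c z * char2 (-l) z ∂periodSq = if l ∈ S then (2*π)^2 * c l else 0 := by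
  have : ∀ z, trigPoly S c z * char2 (-l) z = ∑ k ∈ S, c k * char2 (k - l) z := fun z => by
    rw [trigPoly, Finset.sum_mul]
    refine Finset.sum_congr rfl fun k _ => ?_
    rw [sub_eq_add_neg, char2_add, mul_assoc]
  simp_rw [this]
  rw [integral_finsetSum _ fun k _ => (integrable_char2 _).const_mul _]
  simp_rw [integral_const_mul, integral_char2, sub_eq_zero]
  simp [mul_comm]

lemma integral_norm_sq_trigPoly (S : Finset (ℤ × ℤ)) (c : ℤ × ℤ → ℂ) :
    ∫ z, ‖trigPoly S c z‖ ^ 2 ∂periodSq = (2*π)^2 * ∑ k ∈ S, ‖c k‖ ^ 2 := by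
  have h := integral_mul_conj_trigPoly ((memLp_trigPoly S c 1).integrable le_rfl) S c
  simp_rw [integral_trigPoly_mul_char2] at h
  rw [← Complex.ofReal_inj, ← integral_complex_ofReal]
  simp_rw [Complex.mul_conj, Complex.normSq_eq_norm_sq] at h
  rw [h]
  push_cast
  rw [Finset.mul_sum]
  refine Finset.sum_congr rfl fun k hk => ?_
  rw [if_pos hk, mul_left_comm, mul_comm _ (c k), Complex.mul_conj, Complex.normSq_eq_norm_sq]
  push_cast; ring

/-- If every frequency has at most `B` representations as an ordered sum of `n` elements of `S`,
the moment of order `2 * n` of a trigonometric polynomial on `S` is controlled by its `ℓ²` norm. -/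
lemma integral_norm_pow_trigPoly_le (S : Finset (ℤ × ℤ)) (c : ℤ × ℤ → ℂ) (n B : ℕ)
    (hB : ∀ N : ℤ × ℤ,
      ((Fintype.piFinset fun _ : Fin n => S).filter fun p => ∑ i, p i = N).card ≤ B) :
    ∫ z, ‖trigPoly S c z‖ ^ (2 * n) ∂periodSq ≤ (2*π)^2 * (B * (∑ k ∈ S, ‖c k‖ ^ 2) ^ n) := by
  classical
  set A := Fintype.piFinset fun _ : Fin n => S with hA
  set T := A.image fun p => ∑ i, p i with hT
  set d : ℤ × ℤ → ℂ := fun N => ∑ p ∈ A with ∑ i, p i = N, ∏ i, c (p i) with hd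
  have hpow : ∀ z, trigPoly S c z ^ n = trigPoly T d z := fun z => by
    have h1 : trigPoly S c z ^ n = ∑ p ∈ A, ∏ i, (c (p i) * char2 (p i) z) := by
      rw [hA, ← Finset.prod_univ_sum (fun _ => S) (fun _ k => c k * char2 k z)]
      simp [trigPoly]
    rw [h1, trigPoly, ← Finset.sum_fiberwise_of_maps_to (s := A) (t := T) (g := fun p => ∑ i, p i)
      (fun p hp => Finset.mem_image_of_mem _ hp)]
    refine Finset.sum_congr rfl fun N _ => ?_
    rw [hd, Finset.sum_mul]
    refine Finset.sum_congr rfl fun p hp => ?_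
    rw [Finset.prod_mul_distrib, ← char2_sum, (Finset.mem_filter.1 hp).2]
  have : ∀ z, ‖trigPoly S c z‖ ^ (2 * n) = ‖trigPoly T d z‖ ^ 2 := fun z => by
    rw [← hpow, norm_pow, ← pow_mul, mul_comm]
  simp_rw [this]
  rw [integral_norm_sq_trigPoly]
  gcongr
  calc ∑ N ∈ T, ‖d N‖ ^ 2
      ≤ ∑ N ∈ T, (B * ∑ p ∈ A with ∑ i, p i = N, ‖∏ i, c (p i)‖ ^ 2) := by
        refine Finset.sum_le_sum fun N _ => ?_
        calc ‖d N‖ ^ 2 ≤ (∑ p ∈ A with ∑ i, p i = N, ‖∏ i, c (p i)‖) ^ 2 := by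
              gcongr; exact norm_sum_le _ _
          _ ≤ _ := sq_sum_le_card_mul_sum_sq
          _ ≤ _ := by
              gcongr; exact_mod_cast hB N
    _ = B * ∑ p ∈ A, ‖∏ i, c (p i)‖ ^ 2 := by
        rw [← Finset.mul_sum, Finset.sum_fiberwise_of_maps_to
          (fun p hp => Finset.mem_image_of_mem _ hp)]
    _ = B * (∑ k ∈ S, ‖c k‖ ^ 2) ^ n := by
        congr 1
        have : (∑ k ∈ S, ‖c k‖ ^ 2) ^ n = ∏ _i : Fin n, ∑ k ∈ S, ‖c k‖ ^ 2 := by simp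
        rw [this, Finset.prod_univ_sum]
        refine Finset.sum_congr rfl fun p _ => ?_
        rw [norm_prod, Finset.prod_pow]

/-- The pairs of integers both of which are, up to sign, powers of two. -/
def dyadicFreq : Set (ℤ × ℤ) :=
  {k | (∃ μ : ℕ, k.1.natAbs = 2 ^ μ) ∧ ∃ ν : ℕ, k.2.natAbs = 2 ^ ν}

lemma sum_natAbs_of_sign {n : ℕ} (v : Fin n → ℤ) (b : Bool) (h : ∀ i, decide (0 < v i) = b) :
    ∑ i, (v i).natAbs = ((if b then 1 else -1) * ∑ i, v i).toNat := by
  have : ((∑ i, (v i).natAbs : ℕ) : ℤ) = (if b then 1 else -1) * ∑ i, v i := by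
    push_cast
    rw [Finset.mul_sum]
    refine Finset.sum_congr rfl fun i _ => ?_
    have := h i
    cases b
    · simp only [decide_eq_false_iff_not, not_lt] at this
      simp [abs_of_nonpos this]
    · simp only [decide_eq_true_eq] at this
      simp [abs_of_pos this]
  omega

lemma card_image_log_natAbs_le {n B : ℕ}
    (hB : ∀ (N : ℕ) (T : Finset (Fin n → ℕ)), (∀ p ∈ T, ∑ i, 2 ^ p i = N) → T.card ≤ B)
    {α : Type*} (A : Finset α) (v : α → Fin n → ℤ) (b : Bool) (N : ℤ)
    (hpow : ∀ p ∈ A, ∀ i, ∃ μ : ℕ, (v p i).natAbs = 2 ^ μ)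
    (hsign : ∀ p ∈ A, ∀ i, decide (0 < v p i) = b) (hsum : ∀ p ∈ A, ∑ i, v p i = N) :
    (A.image fun p i => Nat.log 2 (v p i).natAbs).card ≤ B := by
  refine hB (((if b then 1 else -1) * N).toNat) _ fun q hq => ?_
  obtain ⟨p, hp, rfl⟩ := Finset.mem_image.1 hq
  rw [← hsum p hp, ← sum_natAbs_of_sign _ b (hsign p hp)]
  refine Finset.sum_congr rfl fun i _ => ?_
  obtain ⟨μ, hμ⟩ := hpow p hp i
  simp only [hμ, Nat.log_pow (by norm_num : 1 < 2)]

lemma eq_of_log_natAbs_eq {a b : ℤ} (ha : ∃ μ : ℕ, a.natAbs = 2 ^ μ)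
    (hb : ∃ μ : ℕ, b.natAbs = 2 ^ μ) (hs : decide (0 < a) = decide (0 < b))
    (h : Nat.log 2 a.natAbs = Nat.log 2 b.natAbs) : a = b := by
  obtain ⟨μ, hμ⟩ := ha
  obtain ⟨ν, hν⟩ := hb
  rw [hμ, hν, Nat.log_pow (by norm_num), Nat.log_pow (by norm_num)] at h
  subst h
  have : a.natAbs = b.natAbs := by rw [hμ, hν]
  rw [decide_eq_decide] at hs
  omega

lemma card_representations_le {n B : ℕ}
    (hB : ∀ (N : ℕ) (T : Finset (Fin n → ℕ)), (∀ p ∈ T, ∑ i, 2 ^ p i = N) → T.card ≤ B)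
    (S : Finset (ℤ × ℤ)) (hS : ∀ k ∈ S, k ∈ dyadicFreq) (b : Bool × Bool)
    (hb : ∀ k ∈ S, (decide (0 < k.1), decide (0 < k.2)) = b) (N : ℤ × ℤ) :
    ((Fintype.piFinset fun _ : Fin n => S).filter fun p => ∑ i, p i = N).card ≤ B * B := by
  classical
  set A := (Fintype.piFinset fun _ : Fin n => S).filter fun p => ∑ i, p i = N with hA
  have hmem : ∀ p ∈ A, ∀ i, p i ∈ S := fun p hp i =>
    Fintype.mem_piFinset.1 (Finset.mem_filter.1 hp).1 i
  have hsum : ∀ p ∈ A, ∑ i, p i = N := fun p hp => (Finset.mem_filter.1 hp).2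
  have h1 := card_image_log_natAbs_le hB A (fun p i => (p i).1) b.1 N.1
    (fun p hp i => (hS _ (hmem p hp i)).1)
    (fun p hp i => by rw [← hb _ (hmem p hp i)])
    (fun p hp => by rw [← hsum p hp, Prod.fst_sum])
  have h2 := card_image_log_natAbs_le hB A (fun p i => (p i).2) b.2 N.2
    (fun p hp i => (hS _ (hmem p hp i)).2)
    (fun p hp i => by rw [← hb _ (hmem p hp i)])
    (fun p hp => by rw [← hsum p hp, Prod.snd_sum])
  refine le_trans ?_ (Nat.mul_le_mul h1 h2)
  rw [← Finset.card_product]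
  refine Finset.card_le_card_of_injOn
    (fun p => (fun i => Nat.log 2 (p i).1.natAbs, fun i => Nat.log 2 (p i).2.natAbs)) ?_ ?_
  · intro p hp
    exact Finset.mem_product.2 ⟨Finset.mem_image_of_mem (fun p i => Nat.log 2 (p i).1.natAbs) hp,
      Finset.mem_image_of_mem (fun p i => Nat.log 2 (p i).2.natAbs) hp⟩
  · intro p hp q hq hpq
    simp only [Prod.mk.injEq, funext_iff] at hpq
    funext i
    have hp' := hS _ (hmem p hp i)
    have hq' := hS _ (hmem q hq i)
    have hs := (hb _ (hmem p hp i)).trans (hb _ (hmem q hq i)).symm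
    simp only [Prod.mk.injEq] at hs
    exact Prod.ext (eq_of_log_natAbs_eq hp'.1 hq'.1 hs.1 (hpq.1 i))
      (eq_of_log_natAbs_eq hp'.2 hq'.2 hs.2 (hpq.2 i))

lemma eLpNorm_trigPoly_le_of_card (n B : ℕ) (hn : n ≠ 0) (S : Finset (ℤ × ℤ)) (c : ℤ × ℤ → ℂ)
    (hB : ∀ N : ℤ × ℤ,
      ((Fintype.piFinset fun _ : Fin n => S).filter fun p => ∑ i, p i = N).card ≤ B) :
    eLpNorm (trigPoly S c) (2 * n : ℕ) periodSq ≤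
      ENNReal.ofReal (((2*π)^2 * B) ^ ((2 * n : ℝ)⁻¹)) *
        ENNReal.ofReal (√(∑ k ∈ S, ‖c k‖ ^ 2)) := by
  have hs : 0 ≤ ∑ k ∈ S, ‖c k‖ ^ 2 := by positivity
  rw [(memLp_trigPoly S c _).eLpNorm_eq_integral_rpow_norm (by simp [hn])
      (ENNReal.natCast_ne_top _),
    ← ENNReal.ofReal_mul (by positivity)]
  refine ENNReal.ofReal_le_ofReal ?_
  have hcast : ((2 * n : ℕ) : ℝ≥0∞).toReal = (2 * n : ℕ) := by simp
  rw [hcast]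
  simp_rw [Real.rpow_natCast]
  have h := integral_norm_pow_trigPoly_le S c n B hB
  have hn' : (n : ℝ) ≠ 0 := by exact_mod_cast hn
  calc (∫ z, ‖trigPoly S c z‖ ^ (2 * n) ∂periodSq) ^ (((2 * n : ℕ) : ℝ)⁻¹)
      ≤ ((2*π)^2 * (B * (∑ k ∈ S, ‖c k‖ ^ 2) ^ n)) ^ (((2 * n : ℕ) : ℝ)⁻¹) := by
        gcongr
    _ = _ := by
        rw [← mul_assoc, Real.mul_rpow (by positivity) (by positivity), ← Real.rpow_natCast _ n,
          ← Real.rpow_mul hs, Real.sqrt_eq_rpow]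
        push_cast
        congr 2
        field_simp

/-- Zygmund's inequality for lacunary trigonometric polynomials in two variables: every `L_q` norm
is controlled by the `ℓ²` norm of the coefficients. -/
lemma exists_eLpNorm_trigPoly_le (q : ℝ) (hq : 0 < q) : ∃ C : ℝ, 0 < C ∧
    ∀ (S : Finset (ℤ × ℤ)) (c : ℤ × ℤ → ℂ), (∀ k ∈ S, k ∈ dyadicFreq) →
      eLpNorm (trigPoly S c) (ENNReal.ofReal q) periodSq ≤
        ENNReal.ofReal C * ENNReal.ofReal (√(∑ k ∈ S, ‖c k‖ ^ 2)) := by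
  classical
  obtain ⟨n, hn⟩ := exists_nat_ge (max q 1)
  have hn0 : n ≠ 0 := by
    rintro rfl
    have := (le_max_right q 1).trans hn
    norm_num at this
  obtain ⟨B, hB⟩ := exists_card_sum_two_pow_le n
  set D : ℝ≥0∞ := ENNReal.ofReal (((2*π)^2 * (B * B : ℕ)) ^ ((2 * n : ℝ)⁻¹)) with hD
  set V : ℝ≥0∞ := periodSq Set.univ ^
    (1 / (ENNReal.ofReal q).toReal - 1 / ((2 * n : ℕ) : ℝ≥0∞).toReal) with hV
  have hqn : ENNReal.ofReal q ≤ ((2 * n : ℕ) : ℝ≥0∞) := by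
    rw [← ENNReal.ofReal_natCast]
    refine ENNReal.ofReal_le_ofReal ?_
    have := (le_max_left q 1).trans hn
    push_cast
    linarith
  have hVtop : V ≠ ⊤ := by
    refine ENNReal.rpow_ne_top_of_nonneg ?_ (measure_ne_top _ _)
    rw [sub_nonneg]
    refine one_div_le_one_div_of_le ?_ (ENNReal.toReal_mono (ENNReal.natCast_ne_top _) hqn)
    rwa [ENNReal.toReal_ofReal hq.le]
  have hfin : 4 * D * V + 1 ≠ ⊤ := by
    simp [ENNReal.mul_eq_top, hVtop, hD]
  refine ⟨(4 * D * V + 1).toReal, ENNReal.toReal_pos (by simp) hfin, fun S c hS => ?_⟩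
  rw [ENNReal.ofReal_toReal hfin]
  set R := ENNReal.ofReal (√(∑ k ∈ S, ‖c k‖ ^ 2))
  have hquad : ∀ b : Bool × Bool,
      eLpNorm (trigPoly (S.filter fun k => (decide (0 < k.1), decide (0 < k.2)) = b) c)
        (2 * n : ℕ) periodSq ≤ D * R := fun b => by
    refine (eLpNorm_trigPoly_le_of_card n (B * B) hn0 _ c (card_representations_le hB _
      (fun k hk => hS k (Finset.mem_filter.1 hk).1) b
      (fun k hk => (Finset.mem_filter.1 hk).2))).trans ?_
    refine mul_le_mul_right (ENNReal.ofReal_le_ofReal (Real.sqrt_le_sqrt ?_)) _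
    exact Finset.sum_le_sum_of_subset_of_nonneg (Finset.filter_subset _ _)
      fun _ _ _ => by positivity
  have hsplit : trigPoly S c = ∑ b : Bool × Bool,
      trigPoly (S.filter fun k => (decide (0 < k.1), decide (0 < k.2)) = b) c := by
    funext z
    rw [Finset.sum_apply]
    simp only [trigPoly]
    rw [Finset.sum_fiberwise]
  have h2n : eLpNorm (trigPoly S c) (2 * n : ℕ) periodSq ≤ 4 * (D * R) := by
    rw [hsplit]
    refine (eLpNorm_sum_le (fun b _ => (continuous_trigPoly _ c).aestronglyMeasurable) ?_).trans ?_
    · have : 1 ≤ 2 * n := by omega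
      exact_mod_cast this
    · refine (Finset.sum_le_sum fun b _ => hquad b).trans ?_
      simp only [Finset.sum_const, nsmul_eq_mul]
      norm_num
  calc eLpNorm (trigPoly S c) (ENNReal.ofReal q) periodSq
      ≤ eLpNorm (trigPoly S c) (2 * n : ℕ) periodSq * V :=
        eLpNorm_le_eLpNorm_mul_rpow_measure_univ hqn (continuous_trigPoly _ c).aestronglyMeasurable
    _ ≤ 4 * (D * R) * V := by gcongr
    _ = 4 * D * V * R := by ring
    _ ≤ (4 * D * V + 1) * R := by gcongr; exact le_self_add

/-- The (unnormalised) Fourier coefficients on the period square. -/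
def coef2 (F : ℝ × ℝ → ℂ) (k : ℤ × ℤ) : ℂ := ∫ z, F z * char2 (-k) z ∂periodSq

/-- The sum of the squares of the Fourier coefficients. -/
def coefSq (F : ℝ × ℝ → ℂ) : ℝ≥0∞ := ∑' k, ‖coef2 F k‖ₑ ^ 2

lemma sq_le_of_sq_le_mul {x a : ℝ≥0∞} (hx : x ≠ ⊤) (h : x ^ 2 ≤ a * x) : x ≤ a := by
  rcases eq_or_ne x 0 with rfl | h0
  · simp
  · rw [sq] at h
    exact (ENNReal.mul_le_mul_iff_left h0 hx).1 h

lemma sum_enorm_sq_eq (S : Finset (ℤ × ℤ)) (c : ℤ × ℤ → ℂ) :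
    ∑ k ∈ S, ‖c k‖ₑ ^ 2 = ENNReal.ofReal (√(∑ k ∈ S, ‖c k‖ ^ 2)) ^ 2 := by
  rw [← ENNReal.ofReal_pow (by positivity), Real.sq_sqrt (by positivity),
    ENNReal.ofReal_sum_of_nonneg fun _ _ => by positivity]
  refine Finset.sum_congr rfl fun k _ => ?_
  rw [ENNReal.ofReal_pow (norm_nonneg _), ofReal_norm]

/-- The `ℓ²` norm of the Fourier coefficients of a function with lacunary spectrum is controlled by
its `L_p` norm. -/
lemma exists_coefSq_le (p : ℝ) (hp : 1 < p) : ∃ C : ℝ, 0 < C ∧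
    ∀ F : ℝ × ℝ → ℂ, Integrable F periodSq → (∀ k ∉ dyadicFreq, coef2 F k = 0) →
      coefSq F ≤ (ENNReal.ofReal C * eLpNorm F (ENNReal.ofReal p) periodSq) ^ 2 := by
  classical
  have hpq := Real.HolderConjugate.conjExponent hp
  obtain ⟨C, hC, h⟩ := exists_eLpNorm_trigPoly_le p.conjExponent hpq.symm.pos
  refine ⟨C, hC, fun F hF hsupp => ?_⟩
  rw [coefSq, ENNReal.tsum_eq_iSup_sum]
  refine iSup_le fun S => ?_
  have hfil : ∑ k ∈ S, ‖coef2 F k‖ₑ ^ 2 = ∑ k ∈ S with k ∈ dyadicFreq, ‖coef2 F k‖ₑ ^ 2 := by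
    rw [Finset.sum_filter]
    refine Finset.sum_congr rfl fun k _ => ?_
    split_ifs with hk
    · rfl
    · simp [hsupp k hk]
  set T := S.filter (· ∈ dyadicFreq) with hT
  rw [hfil, sum_enorm_sq_eq]
  set X := ENNReal.ofReal (√(∑ k ∈ T, ‖coef2 F k‖ ^ 2)) with hX
  gcongr
  refine sq_le_of_sq_le_mul ENNReal.ofReal_ne_top ?_
  have hP := h T (coef2 F) fun k hk => (Finset.mem_filter.1 hk).2
  have hFint := integral_mul_conj_trigPoly hF T (coef2 F)
  have h1 : X ^ 2 = ‖∫ z, F z * (starRingEnd ℂ) (trigPoly T (coef2 F) z) ∂periodSq‖ₑ := by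
    rw [hFint, hX, ← sum_enorm_sq_eq]
    have : ∀ k, (starRingEnd ℂ) (coef2 F k) * ∫ z, F z * char2 (-k) z ∂periodSq =
        ((‖coef2 F k‖ ^ 2 : ℝ) : ℂ) := fun k => by
      rw [← coef2, mul_comm, Complex.mul_conj, Complex.normSq_eq_norm_sq]
    simp_rw [this]
    rw [← Complex.ofReal_sum, ← ofReal_norm, Complex.norm_real, Real.norm_eq_abs,
      abs_of_nonneg (by positivity), ENNReal.ofReal_sum_of_nonneg fun _ _ => by positivity]
    refine Finset.sum_congr rfl fun k _ => ?_
    rw [ENNReal.ofReal_pow (norm_nonneg _), ofReal_norm]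
  rw [h1]
  have : ENNReal.HolderConjugate (ENNReal.ofReal p) (ENNReal.ofReal p.conjExponent) :=
    hpq.ennrealOfReal
  calc ‖∫ z, F z * (starRingEnd ℂ) (trigPoly T (coef2 F) z) ∂periodSq‖ₑ
      ≤ ∫⁻ z, ‖F z * (starRingEnd ℂ) (trigPoly T (coef2 F) z)‖ₑ ∂periodSq :=
        enorm_integral_le_lintegral_enorm _
    _ = eLpNorm (F • trigPoly T (coef2 F)) 1 periodSq := by
        rw [eLpNorm_one_eq_lintegral_enorm]
        refine lintegral_congr fun z => ?_
        simp [enorm_mul]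
    _ ≤ eLpNorm F (ENNReal.ofReal p) periodSq *
          eLpNorm (trigPoly T (coef2 F)) (ENNReal.ofReal p.conjExponent) periodSq :=
        eLpNorm_smul_le_mul_eLpNorm (continuous_trigPoly _ _).aestronglyMeasurable
          hF.aestronglyMeasurable
    _ ≤ eLpNorm F (ENNReal.ofReal p) periodSq * (ENNReal.ofReal C * X) := by gcongr
    _ = _ := by ring

/-- A square summable family of coefficients on the dyadic frequencies is the family of Fourier
coefficients of a function in `L_q`, with control of its norm. -/
lemma exists_memLp_coef2_eq (q : ℝ) (hq : 1 ≤ q) : ∃ C : ℝ, 0 < C ∧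
    ∀ c : ℤ × ℤ → ℂ, (∀ k ∉ dyadicFreq, c k = 0) → (Summable fun k => ‖c k‖ ^ 2) →
      ∃ G : ℝ × ℝ → ℂ, MemLp G (ENNReal.ofReal q) periodSq ∧ (∀ k, coef2 G k = (2*π)^2 * c k) ∧
        eLpNorm G (ENNReal.ofReal q) periodSq ≤ ENNReal.ofReal (C * √(∑' k, ‖c k‖ ^ 2)) := by
  classical
  obtain ⟨C, hC, h⟩ := exists_eLpNorm_trigPoly_le q (by linarith)
  refine ⟨C, hC, fun c hc hsum => ?_⟩
  set Q := ENNReal.ofReal q with hQ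
  have hQ1 : 1 ≤ Q := by rw [hQ, ← ENNReal.ofReal_one]; exact ENNReal.ofReal_le_ofReal hq
  have : Fact (1 ≤ Q) := ⟨hQ1⟩
  have hbound : ∀ t : Finset (ℤ × ℤ),
      eLpNorm (trigPoly t c) Q periodSq ≤ ENNReal.ofReal (C * √(∑ k ∈ t, ‖c k‖ ^ 2)) := fun t => by
    have h1 : trigPoly t c = trigPoly (t.filter (· ∈ dyadicFreq)) c := by
      funext z
      rw [trigPoly, trigPoly, Finset.sum_filter]
      refine Finset.sum_congr rfl fun k _ => ?_
      split_ifs with hk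
      · rfl
      · simp [hc k hk]
    rw [h1]
    refine (h _ c fun k hk => (Finset.mem_filter.1 hk).2).trans ?_
    rw [← ENNReal.ofReal_mul hC.le]
    gcongr
    exact Finset.filter_subset _ _
  set u : ℤ × ℤ → Lp ℂ Q periodSq := fun k => (memLp_trigPoly {k} c Q).toLp _ with hu
  have husum : ∀ t : Finset (ℤ × ℤ), ∑ k ∈ t, u k = (memLp_trigPoly t c Q).toLp _ := fun t => by
    induction t using Finset.induction_on with
    | empty =>
      rw [Finset.sum_empty, eq_comm, Lp.eq_zero_iff_ae_eq_zero]
      filter_upwards [(memLp_trigPoly ∅ c Q).coeFn_toLp] with z hz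
      rw [hz]; simp [trigPoly]
    | insert a t ha ih =>
      rw [Finset.sum_insert ha, ih, hu, ← MemLp.toLp_add]
      congr 1
      funext z
      simp [trigPoly, Finset.sum_insert ha]
  have hunorm : ∀ t : Finset (ℤ × ℤ), ‖∑ k ∈ t, u k‖ ≤ C * √(∑ k ∈ t, ‖c k‖ ^ 2) := fun t => by
    rw [husum, Lp.norm_toLp]
    exact ENNReal.toReal_le_of_le_ofReal (by positivity) (hbound t)
  have husummable : Summable u := by
    rw [summable_iff_vanishing_norm] at hsum ⊢
    intro ε hε
    obtain ⟨s, hs⟩ := hsum ((ε / C) ^ 2) (by positivity)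
    refine ⟨s, fun t ht => (hunorm t).trans_lt ?_⟩
    have := hs t ht
    rw [Real.norm_eq_abs, abs_of_nonneg (by positivity)] at this
    have h2 : √(∑ k ∈ t, ‖c k‖ ^ 2) < ε / C := by
      rw [Real.sqrt_lt' (by positivity)]; exact this
    calc C * √(∑ k ∈ t, ‖c k‖ ^ 2) < C * (ε / C) := by gcongr
      _ = ε := by field_simp
  set G := ∑' k, u k with hG
  have hlim : Filter.Tendsto (fun t => ∑ k ∈ t, u k) Filter.atTop (nhds G) := husummable.hasSum
  refine ⟨G, Lp.memLp G, fun l => ?_, ?_⟩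
  · have hL1 : Filter.Tendsto (fun t => eLpNorm (trigPoly t c - ⇑G) 1 periodSq)
        Filter.atTop (nhds 0) := by
      have h1 : Filter.Tendsto (fun t => eLpNorm (trigPoly t c - ⇑G) Q periodSq)
          Filter.atTop (nhds 0) := by
        have := (Lp.tendsto_Lp_iff_tendsto_eLpNorm' _ _).1 hlim
        refine this.congr fun t => eLpNorm_congr_ae ?_
        rw [husum]
        filter_upwards [(memLp_trigPoly t c Q).coeFn_toLp] with z hz
        simp [hz]
      set V := periodSq Set.univ ^ (1 / (1 : ℝ≥0∞).toReal - 1 / Q.toReal) with hV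
      have hVtop : V ≠ ⊤ := by
        refine ENNReal.rpow_ne_top_of_nonneg ?_ (measure_ne_top _ _)
        rw [hQ, ENNReal.toReal_ofReal (by linarith), ENNReal.toReal_one, sub_nonneg]
        exact one_div_le_one_div_of_le one_pos hq
      have h2 := ENNReal.Tendsto.mul_const h1 (Or.inr hVtop)
      rw [zero_mul] at h2
      exact tendsto_of_tendsto_of_tendsto_of_le_of_le tendsto_const_nhds h2
        (fun _ => zero_le) (fun t => eLpNorm_le_eLpNorm_mul_rpow_measure_univ hQ1
          ((continuous_trigPoly t c).aestronglyMeasurable.sub (Lp.aestronglyMeasurable G)))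
    have hGint : Integrable G periodSq := (Lp.memLp G).integrable hQ1
    have hconv : Filter.Tendsto (fun t => ∫ z, trigPoly t c z * char2 (-l) z ∂periodSq)
        Filter.atTop (nhds (coef2 G l)) := by
      refine tendsto_integral_of_L1' (fun z => G z * char2 (-l) z)
        (integrable_mul_char2 hGint _).aestronglyMeasurable
        (Filter.Eventually.of_forall fun t =>
          integrable_mul_char2 ((memLp_trigPoly t c 1).integrable le_rfl) _) ?_
      refine hL1.congr fun t => ?_
      refine eLpNorm_congr_norm_ae (Filter.Eventually.of_forall fun z => ?_)
      simp only [Pi.sub_apply]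
      rw [← sub_mul, norm_mul, norm_char2, mul_one]
    refine tendsto_nhds_unique hconv (tendsto_const_nhds.congr' ?_)
    filter_upwards [Filter.eventually_ge_atTop {l}] with t ht
    rw [integral_trigPoly_mul_char2, if_pos (ht (Finset.mem_singleton_self l))]
  · have hn : ‖G‖ ≤ C * √(∑' k, ‖c k‖ ^ 2) := by
      refine le_of_tendsto hlim.norm (Filter.Eventually.of_forall fun t => (hunorm t).trans ?_)
      gcongr
      exact hsum.sum_le_tsum _ fun _ _ => by positivity
    rw [← ENNReal.ofReal_toReal (Lp.eLpNorm_ne_top G), ← Lp.norm_def]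
    exact ENNReal.ofReal_le_ofReal hn

/-- The projection of the plane onto the torus, with period `2π` in each variable. -/
def toTorus (z : ℝ × ℝ) : UnitAddTorus (Fin 2) :=
  ![((z.1 / (2*π) : ℝ) : UnitAddCircle), ((z.2 / (2*π) : ℝ) : UnitAddCircle)]

lemma continuous_toTorus : Continuous toTorus := by
  refine continuous_pi fun i => ?_
  fin_cases i
  · exact (AddCircle.continuous_mk' 1).comp (by fun_prop : Continuous fun z : ℝ × ℝ => z.1 / (2*π))
  · exact (AddCircle.continuous_mk' 1).comp (by fun_prop : Continuous fun z : ℝ × ℝ => z.2 / (2*π))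

/-- A measurable section of `toTorus` with values in the period square. -/
def ofTorus (t : UnitAddTorus (Fin 2)) : ℝ × ℝ :=
  (2*π * (AddCircle.measurableEquivIoc 1 0 (t 0) : ℝ),
    2*π * (AddCircle.measurableEquivIoc 1 0 (t 1) : ℝ))

lemma measurable_ofTorus : Measurable ofTorus := by
  have h : ∀ i, Measurable fun t : UnitAddTorus (Fin 2) =>
      2*π * (AddCircle.measurableEquivIoc 1 0 (t i) : ℝ) := fun i =>
    (measurable_subtype_coe.comp ((AddCircle.measurableEquivIoc 1 0).measurable.comp
      (measurable_pi_apply (X := fun _ : Fin 2 => UnitAddCircle) i))).const_mul _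
  exact (h 0).prodMk (h 1)

lemma measurableEquivIoc_coe_div {x : ℝ} (hx : x ∈ Set.Ioc 0 (2*π)) :
    2*π * (AddCircle.measurableEquivIoc 1 0 ((x / (2*π) : ℝ) : UnitAddCircle) : ℝ) = x := by
  have h : x / (2*π) ∈ Set.Ioc (0:ℝ) (0 + 1) := by
    constructor
    · have := hx.1; positivity
    · rw [zero_add, div_le_one (by positivity)]; exact hx.2
  have h2 : (AddCircle.measurableEquivIoc 1 0 ((x / (2*π) : ℝ) : UnitAddCircle) : ℝ) =
      x / (2*π) := by
    change ((AddCircle.equivIoc 1 0 ((x / (2*π) : ℝ) : UnitAddCircle)) : ℝ) = _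
    rw [AddCircle.equivIoc_coe_eq h]
  rw [h2]
  field_simp

lemma ae_periodSq_mem : ∀ᵐ z ∂periodSq, z ∈ Set.Ioc (0:ℝ) (2*π) ×ˢ Set.Ioc (0:ℝ) (2*π) := by
  rw [periodSq, Measure.prod_restrict]
  exact ae_restrict_mem (measurableSet_Ioc.prod measurableSet_Ioc)

lemma ofTorus_toTorus_ae : ∀ᵐ z ∂periodSq, ofTorus (toTorus z) = z := by
  filter_upwards [ae_periodSq_mem] with z hz
  exact Prod.ext (measurableEquivIoc_coe_div hz.1) (measurableEquivIoc_coe_div hz.2)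

lemma mFourier_toTorus (n : Fin 2 → ℤ) (z : ℝ × ℝ) :
    UnitAddTorus.mFourier n (toTorus z) = char2 (n 0, n 1) z := by
  simp only [UnitAddTorus.mFourier, ContinuousMap.coe_mk, Fin.prod_univ_two, toTorus,
    Matrix.cons_val_zero, Matrix.cons_val_one, fourier_coe_apply]
  rw [char2, ← Complex.exp_add]
  congr 1
  push_cast
  field_simp

lemma integrable_mul_comp_toTorus {F : ℝ × ℝ → ℂ} (hF : Integrable F periodSq)
    (g : C(UnitAddTorus (Fin 2), ℂ)) : Integrable (fun z => F z * g (toTorus z)) periodSq :=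
  hF.mul_bdd (c := ‖g‖) (g.continuous.comp continuous_toTorus).aestronglyMeasurable
    (Filter.Eventually.of_forall fun _ => g.norm_coe_le_norm _)

lemma integral_mul_comp_toTorus_eq_zero {F : ℝ × ℝ → ℂ} (hF : Integrable F periodSq)
    (h0 : ∀ k, coef2 F k = 0) (g : C(UnitAddTorus (Fin 2), ℂ)) :
    ∫ z, F z * g (toTorus z) ∂periodSq = 0 := by
  set L : C(UnitAddTorus (Fin 2), ℂ) →ₗ[ℂ] ℂ :=
    { toFun := fun g => ∫ z, F z * g (toTorus z) ∂periodSq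
      map_add' := fun g₁ g₂ => by
        rw [← integral_add (integrable_mul_comp_toTorus hF g₁) (integrable_mul_comp_toTorus hF g₂)]
        refine integral_congr_ae (Filter.Eventually.of_forall fun z => ?_)
        simp [mul_add]
      map_smul' := fun c g => by
        rw [RingHom.id_apply, smul_eq_mul, ← integral_const_mul]
        refine integral_congr_ae (Filter.Eventually.of_forall fun z => ?_)
        simp; ring } with hL
  have hLb : ∀ g, ‖L g‖ ≤ (∫ z, ‖F z‖ ∂periodSq) * ‖g‖ := fun g => by
    refine (norm_integral_le_integral_norm _).trans ?_
    rw [← integral_mul_const]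
    refine integral_mono (integrable_mul_comp_toTorus hF g).norm (hF.norm.mul_const _) fun z => ?_
    simp only [norm_mul]
    gcongr
    exact g.norm_coe_le_norm _
  set L' := L.mkContinuous _ hLb with hL'
  have hspan : Submodule.span ℂ (Set.range (UnitAddTorus.mFourier (d := Fin 2))) ≤
      LinearMap.ker L'.toLinearMap := by
    rw [Submodule.span_le]
    rintro _ ⟨n, rfl⟩
    change ∫ z, F z * UnitAddTorus.mFourier n (toTorus z) ∂periodSq = 0
    simp_rw [mFourier_toTorus]
    have := h0 (-(n 0, n 1))
    rwa [coef2, neg_neg] at this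
  have hclosed : IsClosed (LinearMap.ker L'.toLinearMap : Set C(UnitAddTorus (Fin 2), ℂ)) :=
    L'.isClosed_ker
  have := Submodule.topologicalClosure_minimal _ hspan hclosed
  rw [UnitAddTorus.span_mFourier_closure_eq_top] at this
  exact this (Submodule.mem_top (x := g))

lemma ae_eq_zero_of_integral_mul_comp_toTorus {u : ℝ × ℝ → ℝ} (hu : Integrable u periodSq)
    (h0 : ∀ g : C(UnitAddTorus (Fin 2), ℝ), ∫ z, u z * g (toTorus z) ∂periodSq = 0) :
    u =ᵐ[periodSq] 0 := by
  set ν₁ := periodSq.withDensity fun z => ENNReal.ofReal (u z) with hν₁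
  set ν₂ := periodSq.withDensity fun z => ENNReal.ofReal (-u z) with hν₂
  have hm₁ : AEMeasurable (fun z => ENNReal.ofReal (u z)) periodSq :=
    hu.aestronglyMeasurable.aemeasurable.ennreal_ofReal
  have hm₂ : AEMeasurable (fun z => ENNReal.ofReal (-u z)) periodSq :=
    hu.aestronglyMeasurable.aemeasurable.neg.ennreal_ofReal
  have hf₁ : ∫⁻ z, ENNReal.ofReal (u z) ∂periodSq ≠ ⊤ := hu.lintegral_lt_top.ne
  have hf₂ : ∫⁻ z, ENNReal.ofReal (-u z) ∂periodSq ≠ ⊤ := hu.neg.lintegral_lt_top.ne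
  have : IsFiniteMeasure ν₁ := isFiniteMeasure_withDensity hf₁
  have : IsFiniteMeasure ν₂ := isFiniteMeasure_withDensity hf₂
  have hmT : Measurable toTorus := continuous_toTorus.measurable
  have hmap : ν₁.map toTorus = ν₂.map toTorus := by
    refine ext_of_forall_integral_eq_of_IsFiniteMeasure fun g => ?_
    have hg : AEStronglyMeasurable (fun z => g (toTorus z)) periodSq :=
      (g.continuous.comp continuous_toTorus).aestronglyMeasurable
    rw [integral_map hmT.aemeasurable g.continuous.aestronglyMeasurable,
      integral_map hmT.aemeasurable g.continuous.aestronglyMeasurable,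
      integral_withDensity_eq_integral_toReal_smul₀ hm₁
        (Filter.Eventually.of_forall fun _ => ENNReal.ofReal_lt_top),
      integral_withDensity_eq_integral_toReal_smul₀ hm₂
        (Filter.Eventually.of_forall fun _ => ENNReal.ofReal_lt_top), ← sub_eq_zero,
      ← integral_sub]
    · rw [← h0 g.toContinuousMap]
      refine integral_congr_ae (Filter.Eventually.of_forall fun z => ?_)
      simp only [smul_eq_mul, ENNReal.toReal_ofReal', ← sub_mul]
      congr 1
      rcases le_total 0 (u z) with h | h
      · rw [max_eq_left h, max_eq_right (by linarith)]; ring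
      · rw [max_eq_right h, max_eq_left (by linarith)]; ring
    · refine Integrable.mul_bdd (c := ‖g‖) ?_ hg (Filter.Eventually.of_forall fun z =>
        g.norm_coe_le_norm _)
      simpa only [ENNReal.toReal_ofReal'] using hu.pos_part
    · refine Integrable.mul_bdd (c := ‖g‖) ?_ hg (Filter.Eventually.of_forall fun z =>
        g.norm_coe_le_norm _)
      simpa only [ENNReal.toReal_ofReal'] using hu.neg_part
  have hback : ∀ ν : Measure (ℝ × ℝ), ν ≪ periodSq → (ν.map toTorus).map ofTorus = ν :=
      fun ν hν => by
    rw [Measure.map_map measurable_ofTorus hmT]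
    conv_rhs => rw [← Measure.map_id (μ := ν)]
    exact Measure.map_congr (hν.ae_le ofTorus_toTorus_ae)
  have hν : ν₁ = ν₂ := by
    rw [← hback ν₁ (withDensity_absolutelyContinuous _ _), hmap,
      hback ν₂ (withDensity_absolutelyContinuous _ _)]
  have := (withDensity_eq_iff hm₁ hm₂ hf₁).1 hν
  filter_upwards [this] with z hz
  rcases le_total 0 (u z) with h | h
  · rw [ENNReal.ofReal_of_nonpos (p := -u z) (by linarith), ENNReal.ofReal_eq_zero] at hz
    exact le_antisymm hz h
  · rw [ENNReal.ofReal_of_nonpos h, eq_comm, ENNReal.ofReal_eq_zero] at hz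
    simp only [Pi.zero_apply]
    linarith

/-- An integrable function on the period square is determined by its Fourier coefficients. -/
lemma ae_eq_zero_of_coef2_eq_zero {F : ℝ × ℝ → ℂ} (hF : Integrable F periodSq)
    (h0 : ∀ k, coef2 F k = 0) : F =ᵐ[periodSq] 0 := by
  have key : ∀ g : C(UnitAddTorus (Fin 2), ℝ), ∫ z, F z * ((g (toTorus z) : ℝ) : ℂ) ∂periodSq = 0 :=
    fun g => integral_mul_comp_toTorus_eq_zero hF h0
      ⟨fun t => (g t : ℂ), Complex.continuous_ofReal.comp g.continuous⟩
  have hFint : ∀ g : C(UnitAddTorus (Fin 2), ℝ),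
      Integrable (fun z => F z * ((g (toTorus z) : ℝ) : ℂ)) periodSq :=
    fun g => integrable_mul_comp_toTorus hF
      ⟨fun t => (g t : ℂ), Complex.continuous_ofReal.comp g.continuous⟩
  have hre := ae_eq_zero_of_integral_mul_comp_toTorus hF.re fun g => by
    have := integral_re (hFint g)
    rw [key g] at this
    simpa using this
  have him := ae_eq_zero_of_integral_mul_comp_toTorus hF.im fun g => by
    have := integral_im (hFint g)
    rw [key g] at this
    simpa using this
  filter_upwards [hre, him] with z h1 h2
  exact Complex.ext h1 h2

lemma coef2_sub {F G : ℝ × ℝ → ℂ} (hF : Integrable F periodSq) (hG : Integrable G periodSq)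
    (k : ℤ × ℤ) : coef2 (F - G) k = coef2 F k - coef2 G k := by
  rw [coef2, coef2, coef2,
    ← integral_sub (integrable_mul_char2 hF _) (integrable_mul_char2 hG _)]
  refine integral_congr_ae (Filter.Eventually.of_forall fun z => ?_)
  simp [sub_mul]

lemma ae_eq_of_coef2_eq {F G : ℝ × ℝ → ℂ} (hF : Integrable F periodSq)
    (hG : Integrable G periodSq) (h : ∀ k, coef2 F k = coef2 G k) : F =ᵐ[periodSq] G := by
  have := ae_eq_zero_of_coef2_eq_zero (hF.sub hG) fun k => by rw [coef2_sub hF hG, h, sub_self]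
  filter_upwards [this] with z hz
  exact sub_eq_zero.1 hz

/-- The `L_p` norm of a function with lacunary spectrum is controlled by the `ℓ²` norm of its
Fourier coefficients. -/
lemma exists_eLpNorm_sq_le_coefSq (p : ℝ) (hp : 1 ≤ p) : ∃ C : ℝ, 0 < C ∧
    ∀ F : ℝ × ℝ → ℂ, Integrable F periodSq → (∀ k ∉ dyadicFreq, coef2 F k = 0) →
      eLpNorm F (ENNReal.ofReal p) periodSq ^ 2 ≤ ENNReal.ofReal C * coefSq F := by
  obtain ⟨C, hC, h⟩ := exists_memLp_coef2_eq p hp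
  refine ⟨C ^ 2, by positivity, fun F hF hsupp => ?_⟩
  rcases eq_or_ne (coefSq F) ⊤ with htop | htop
  · rw [htop, ENNReal.mul_top (by simpa using by positivity)]; exact le_top
  set c : ℤ × ℤ → ℂ := fun k => ((2*π : ℂ)^2)⁻¹ * coef2 F k with hc
  have hpi : (1:ℝ) ≤ (2*π)^2 := by nlinarith [Real.pi_gt_three]
  have hcle : ∀ k, ‖c k‖ ^ 2 ≤ ‖coef2 F k‖ ^ 2 := fun k => by
    gcongr
    rw [hc]
    simp only [norm_mul]
    refine mul_le_of_le_one_left (norm_nonneg _) ?_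
    rw [norm_inv]
    refine inv_le_one_of_one_le₀ ?_
    rw [norm_pow, norm_mul, Complex.norm_real, Complex.norm_ofNat, Real.norm_eq_abs,
      abs_of_pos Real.pi_pos]
    exact hpi
  have hterm : ∀ k, ‖coef2 F k‖ₑ ^ 2 = ENNReal.ofReal (‖coef2 F k‖ ^ 2) := fun k => by
    rw [ENNReal.ofReal_pow (norm_nonneg _), ofReal_norm]
  have hsumF : Summable fun k => ‖coef2 F k‖ ^ 2 := by
    have := ENNReal.summable_toReal htop
    refine this.congr fun k => ?_
    rw [hterm, ENNReal.toReal_ofReal (by positivity)]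
  have hsumc : Summable fun k => ‖c k‖ ^ 2 :=
    Summable.of_nonneg_of_le (fun _ => by positivity) hcle hsumF
  obtain ⟨G, hGp, hGc, hGn⟩ := h c (fun k hk => by simp [hc, hsupp k hk]) hsumc
  have hGi : Integrable G periodSq := hGp.integrable (by
    rw [← ENNReal.ofReal_one]; exact ENNReal.ofReal_le_ofReal hp)
  have hFG : F =ᵐ[periodSq] G := ae_eq_of_coef2_eq hF hGi fun k => by
    have : (2*π : ℂ)^2 ≠ 0 := by simp [Real.pi_ne_zero]
    rw [hGc, hc, mul_inv_cancel_left₀ this]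
  rw [eLpNorm_congr_ae hFG]
  calc eLpNorm G (ENNReal.ofReal p) periodSq ^ 2
      ≤ ENNReal.ofReal (C * √(∑' k, ‖c k‖ ^ 2)) ^ 2 := by gcongr
    _ = ENNReal.ofReal (C ^ 2 * ∑' k, ‖c k‖ ^ 2) := by
        rw [← ENNReal.ofReal_pow (by positivity), mul_pow,
          Real.sq_sqrt (tsum_nonneg fun _ => by positivity)]
    _ ≤ ENNReal.ofReal (C ^ 2 * ∑' k, ‖coef2 F k‖ ^ 2) := by
        refine ENNReal.ofReal_le_ofReal ?_
        gcongr C ^ 2 * ?_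
        exact hsumc.tsum_le_tsum hcle hsumF
    _ = ENNReal.ofReal (C ^ 2) * coefSq F := by
        rw [ENNReal.ofReal_mul (by positivity),
          ENNReal.ofReal_tsum_of_nonneg (fun _ => by positivity) hsumF, coefSq]
        simp_rw [hterm]

lemma fracBinom_succ (α : ℝ) (n : ℕ) :
    fracBinom α (n + 1) = fracBinom α n * (α - (n : ℝ)) / ((n : ℝ) + 1) := rfl

lemma fracBinom_eq_choose (α : ℝ) (n : ℕ) : fracBinom α n = Ring.choose α n := by
  induction n with
  | zero => simp [fracBinom]
  | succ n ih =>
    have h : (descPochhammer ℤ (n + 1)).smeval α =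
        (descPochhammer ℤ n).smeval α * (α - n) := by
      rw [descPochhammer_succ_right, Polynomial.smeval_mul, Polynomial.smeval_sub,
        Polynomial.smeval_X, Polynomial.smeval_natCast]
      simp
    rw [fracBinom_succ, ih, Ring.choose_eq_smul, Ring.choose_eq_smul, h, Nat.factorial_succ]
    have : (n.factorial : ℝ) ≠ 0 := by positivity
    simp only [smul_eq_mul]
    push_cast
    field_simp

lemma summable_abs_fracBinom {α : ℝ} (hα : 0 < α) : Summable fun ν => |fracBinom α ν| := by
  obtain ⟨N, hN⟩ := exists_nat_ge α
  rw [← summable_nat_add_iff N]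
  have key : ∀ n, α * |fracBinom α (n + N)| =
      (n + N) * |fracBinom α (n + N)| - (n + 1 + N) * |fracBinom α (n + 1 + N)| := fun n => by
    rw [show n + 1 + N = (n + N) + 1 by ring, fracBinom_succ]
    rw [abs_div, abs_mul, abs_of_nonpos (a := α - _), abs_of_pos (a := _ + _)]
    · have : (n : ℝ) + N + 1 ≠ 0 := by positivity
      push_cast
      field_simp
      ring
    · positivity
    · push_cast; linarith [(Nat.cast_nonneg n : (0:ℝ) ≤ n)]
  refine summable_of_sum_range_le (c := N * |fracBinom α N| / α) (fun _ => abs_nonneg _) fun n => ?_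
  rw [le_div_iff₀ hα, mul_comm, Finset.mul_sum]
  have : ∀ n : ℕ, ∑ i ∈ Finset.range n, α * |fracBinom α (i + N)| =
      N * |fracBinom α N| - (n + N) * |fracBinom α (n + N)| := fun n => by
    induction n with
    | zero => simp
    | succ n ih => rw [Finset.sum_range_succ, ih, key]; push_cast; ring
  rw [this]
  have : 0 ≤ ((n:ℝ) + N) * |fracBinom α (n + N)| := by positivity
  linarith

lemma hasSum_fracBinom_mul_pow (α : ℝ) {z : ℂ} (hz : ‖z‖ < 1) :
    HasSum (fun ν => (fracBinom α ν : ℂ) * z ^ ν) ((1 + z) ^ (α : ℂ)) := by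
  have h := (Complex.one_add_cpow_hasFPowerSeriesOnBall_zero (a := (α : ℂ))).hasSum (y := z) (by
    rw [Metric.mem_eball, edist_zero_right, ← ofReal_norm, ← ENNReal.ofReal_one]
    exact (ENNReal.ofReal_lt_ofReal_iff one_pos).2 hz)
  simp only [binomialSeries_apply, zero_add, List.ofFn_const, List.prod_replicate,
    smul_eq_mul] at h
  simpa only [fracBinom_eq_choose, Complex.ofReal_choose] using h

lemma norm_tsum_fracBinom_mul_pow {α : ℝ} (hα : 0 < α) {z : ℂ} (hz : ‖z‖ = 1) :
    ‖∑' ν, (fracBinom α ν : ℂ) * z ^ ν‖ = ‖1 + z‖ ^ α := by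
  have h1 : Filter.Tendsto (fun ρ : ℝ => ∑' ν, (fracBinom α ν : ℂ) * ((ρ : ℂ) * z) ^ ν)
      (nhdsWithin 1 (Set.Ioo 0 1)) (nhds (∑' ν, (fracBinom α ν : ℂ) * z ^ ν)) := by
    refine tendsto_tsum_of_dominated_convergence (summable_abs_fracBinom hα) (fun ν => ?_) ?_
    · have : Continuous fun ρ : ℝ => (fracBinom α ν : ℂ) * ((ρ : ℂ) * z) ^ ν := by fun_prop
      have := (this.tendsto 1).mono_left (nhdsWithin_le_nhds (s := Set.Ioo 0 1))
      simpa using this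
    · filter_upwards [self_mem_nhdsWithin] with ρ hρ ν
      rw [norm_mul, Complex.norm_real, norm_pow, norm_mul, hz, mul_one, Complex.norm_real,
        Real.norm_eq_abs, Real.norm_eq_abs, abs_of_pos hρ.1]
      exact mul_le_of_le_one_right (abs_nonneg _) (pow_le_one₀ hρ.1.le hρ.2.le)
  have h2 : Filter.Tendsto (fun ρ : ℝ => ‖1 + (ρ : ℂ) * z‖ ^ α)
      (nhdsWithin 1 (Set.Ioo 0 1)) (nhds (‖1 + z‖ ^ α)) := by
    have : Continuous fun ρ : ℝ => ‖1 + (ρ : ℂ) * z‖ ^ α :=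
      (by fun_prop : Continuous fun ρ : ℝ => ‖1 + (ρ : ℂ) * z‖).rpow_const fun _ => Or.inr hα.le
    simpa using (this.tendsto 1).mono_left (nhdsWithin_le_nhds (s := Set.Ioo 0 1))
  have hne : (nhdsWithin (1:ℝ) (Set.Ioo 0 1)).NeBot := by
    rw [← mem_closure_iff_nhdsWithin_neBot, closure_Ioo (by norm_num)]
    exact ⟨by norm_num, by norm_num⟩
  refine tendsto_nhds_unique (h1.norm.congr' ?_) h2
  filter_upwards [self_mem_nhdsWithin] with ρ hρ
  rw [(hasSum_fracBinom_mul_pow α _).tsum_eq, Complex.norm_cpow_real]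
  rw [norm_mul, hz, mul_one, Complex.norm_real, Real.norm_eq_abs, abs_of_pos hρ.1]
  exact hρ.2

/-- The symbol of the fractional difference of order `α`. -/
def diffSymbol (α θ : ℝ) : ℂ :=
  ∑' ν : ℕ, (((-1) ^ ν * fracBinom α ν : ℝ) : ℂ) *
    Complex.exp (Complex.I * (((α - ν) * θ : ℝ) : ℂ))

lemma norm_diffSymbol {α : ℝ} (hα : 0 < α) (θ : ℝ) :
    ‖diffSymbol α θ‖ = |2 * Real.sin (θ / 2)| ^ α := by
  have hz : ‖-Complex.exp (Complex.I * ((-θ : ℝ) : ℂ))‖ = 1 := by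
    rw [norm_neg, mul_comm, Complex.norm_exp_ofReal_mul_I]
  have h := norm_tsum_fracBinom_mul_pow hα hz
  have h2 : diffSymbol α θ = Complex.exp (Complex.I * ((α * θ : ℝ) : ℂ)) *
      ∑' ν, (fracBinom α ν : ℂ) * (-Complex.exp (Complex.I * ((-θ : ℝ) : ℂ))) ^ ν := by
    rw [diffSymbol, ← tsum_mul_left]
    refine tsum_congr fun ν => ?_
    rw [neg_pow (Complex.exp _), ← Complex.exp_nat_mul, show Complex.I * (((α - ν) * θ : ℝ) : ℂ) =
      Complex.I * ((α * θ : ℝ) : ℂ) + ν * (Complex.I * ((-θ : ℝ) : ℂ)) by push_cast; ring,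
      Complex.exp_add]
    push_cast
    ring
  rw [h2, norm_mul, h, mul_comm Complex.I, Complex.norm_exp_ofReal_mul_I, one_mul,
    ← sub_eq_add_neg, norm_sub_rev, Complex.norm_exp_I_mul_ofReal_sub_one, Real.norm_eq_abs,
    neg_div, Real.sin_neg, mul_neg, abs_neg]

lemma setLIntegral_Ioc_add_of_periodic {u : ℝ → ℝ≥0∞} (hu : Function.Periodic u (2*π)) (s : ℝ) :
    ∫⁻ y in Set.Ioc 0 (2*π), u (y + s) = ∫⁻ y in Set.Ioc 0 (2*π), u y := by
  have h1 : ∫⁻ y in Set.Ioc 0 (2*π), u (y + s) = ∫⁻ y in Set.Ioc s (s + 2*π), u y := by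
    have := (measurePreserving_add_right volume s).setLIntegral_comp_preimage_emb
      (measurableEmbedding_addRight s) u (Set.Ioc s (s + 2*π))
    rw [← this]
    simp
  rw [h1]
  have h2 := (isAddFundamentalDomain_Ioc (T := 2*π) (by positivity) s).setLIntegral_eq
    (isAddFundamentalDomain_Ioc (T := 2*π) (by positivity) 0) u (fun g x => by
      obtain ⟨n, hn⟩ := AddSubgroup.mem_zmultiples_iff.1 g.2
      rw [AddSubgroup.vadd_def, ← hn, vadd_eq_add, add_comm]
      exact hu.zsmul n x)
  rw [h2, zero_add]

/-- A real function on the plane, `2π`-periodic in each variable, measurable, and integrable over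
the period square. -/
structure PeriodicIntegrable (f : ℝ → ℝ → ℝ) : Prop where
  meas : Measurable (Function.uncurry f)
  periodic_x : ∀ y, Function.Periodic (fun x => f x y) (2*π)
  periodic_y : ∀ x, Function.Periodic (f x) (2*π)
  integrable : Integrable (Function.uncurry f) periodSq

/-- A real function of two variables, viewed as a complex function on the plane. -/
def toPlane (f : ℝ → ℝ → ℝ) (z : ℝ × ℝ) : ℂ := (f z.1 z.2 : ℂ)

lemma PeriodicIntegrable.integrable_toPlane {f : ℝ → ℝ → ℝ} (hf : PeriodicIntegrable f) :
    Integrable (toPlane f) periodSq := hf.integrable.ofReal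

lemma PeriodicIntegrable.measurable_shift {f : ℝ → ℝ → ℝ} (hf : PeriodicIntegrable f) (s : ℝ) :
    Measurable fun z : ℝ × ℝ => f z.1 (z.2 + s) :=
  hf.meas.comp (by fun_prop : Measurable fun z : ℝ × ℝ => (z.1, z.2 + s))

lemma PeriodicIntegrable.lintegral_shift {f : ℝ → ℝ → ℝ} (hf : PeriodicIntegrable f) (s : ℝ) :
    ∫⁻ z, ‖f z.1 (z.2 + s)‖ₑ ∂periodSq = ∫⁻ z, ‖f z.1 z.2‖ₑ ∂periodSq := by
  have h0 : Measurable fun z : ℝ × ℝ => f z.1 z.2 := hf.meas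
  rw [periodSq, lintegral_prod _ (hf.measurable_shift s).enorm.aemeasurable,
    lintegral_prod _ h0.enorm.aemeasurable]
  refine lintegral_congr fun x => ?_
  exact setLIntegral_Ioc_add_of_periodic (u := fun y => ‖f x y‖ₑ)
    (fun y => by simp only [hf.periodic_y x y]) s

lemma PeriodicIntegrable.lintegral_lt_top {f : ℝ → ℝ → ℝ} (hf : PeriodicIntegrable f) :
    ∫⁻ z, ‖f z.1 z.2‖ₑ ∂periodSq < ⊤ := hf.integrable.2

lemma PeriodicIntegrable.integrable_shift {f : ℝ → ℝ → ℝ} (hf : PeriodicIntegrable f) (s : ℝ) :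
    Integrable (fun z : ℝ × ℝ => f z.1 (z.2 + s)) periodSq :=
  ⟨(hf.measurable_shift s).aestronglyMeasurable, by
    rw [HasFiniteIntegral, hf.lintegral_shift]; exact hf.lintegral_lt_top⟩

lemma PeriodicIntegrable.integral_shift {f : ℝ → ℝ → ℝ} (hf : PeriodicIntegrable f) (s : ℝ)
    (k : ℤ × ℤ) : ∫ z, (f z.1 (z.2 + s) : ℂ) * char2 (-k) z ∂periodSq =
      Complex.exp (Complex.I * ((k.2 * s : ℝ) : ℂ)) * coef2 (toPlane f) k := by
  have h : ∀ z : ℝ × ℝ, (f z.1 (z.2 + s) : ℂ) * char2 (-k) z =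
      Complex.exp (Complex.I * ((k.2 * s : ℝ) : ℂ)) *
        ((f z.1 (z.2 + s) : ℂ) * char2 (-k) (z.1, z.2 + s)) := fun z => by
    rw [mul_left_comm, char2, char2, ← Complex.exp_add]
    congr 2
    simp; ring
  simp_rw [h]
  rw [integral_const_mul, coef2]
  congr 1
  have hi1 : Integrable (fun z => toPlane f z * char2 (-k) z) periodSq :=
    integrable_mul_char2 hf.integrable_toPlane _
  have hi2 : Integrable (fun z : ℝ × ℝ => (f z.1 (z.2 + s) : ℂ) * char2 (-k) (z.1, z.2 + s))
      periodSq := by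
    refine (hf.integrable_shift s).ofReal.mul_bdd (c := 1) ?_
      (Filter.Eventually.of_forall fun z => (norm_char2 _ _).le)
    exact ((continuous_char2 _).comp (by fun_prop : Continuous fun z : ℝ × ℝ =>
      (z.1, z.2 + s))).aestronglyMeasurable
  rw [periodSq] at hi1 hi2 ⊢
  rw [integral_prod _ hi1, integral_prod _ hi2]
  refine integral_congr_ae (Filter.Eventually.of_forall fun x => ?_)
  have hper : Function.Periodic (fun y => (f x y : ℂ) * char2 (-k) (x, y)) (2*π) := fun y => by
    simp only [hf.periodic_y x y]
    congr 1
    rw [char2, char2, Complex.exp_eq_exp_iff_exists_int]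
    exact ⟨-k.2, by push_cast; simp; ring⟩
  have hpi : (0:ℝ) ≤ 2*π := by positivity
  simp only [toPlane]
  rw [← intervalIntegral.integral_of_le hpi, ← intervalIntegral.integral_of_le hpi,
    intervalIntegral.integral_comp_add_right (fun y => (f x y : ℂ) * char2 (-k) (x, y)) s,
    zero_add, add_comm (2*π) s, hper.intervalIntegral_add_eq s 0, zero_add]

lemma PeriodicIntegrable.diffY {f : ℝ → ℝ → ℝ} (hf : PeriodicIntegrable f) {α : ℝ} (hα : 0 < α)
    (h : ℝ) : PeriodicIntegrable (diffY α h f) where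
  meas := Measurable.tsum (f := fun ν (z : ℝ × ℝ) =>
      (-1 : ℝ) ^ ν * fracBinom α ν * f z.1 (z.2 + (α - (ν : ℝ)) * h))
    fun ν => (hf.measurable_shift _).const_mul _
  periodic_x y x := tsum_congr fun ν => congrArg _ (hf.periodic_x _ x)
  periodic_y x y := tsum_congr fun ν => by rw [add_right_comm, hf.periodic_y x]
  integrable := by
    refine ⟨(Measurable.tsum (f := fun ν (z : ℝ × ℝ) =>
      (-1 : ℝ) ^ ν * fracBinom α ν * f z.1 (z.2 + (α - (ν : ℝ)) * h))
      fun ν => (hf.measurable_shift _).const_mul _).aestronglyMeasurable, ?_⟩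
    calc ∫⁻ z, ‖Function.uncurry (_root_.diffY α h f) z‖ₑ ∂periodSq
        ≤ ∫⁻ z, ∑' ν : ℕ, ‖(-1 : ℝ) ^ ν * fracBinom α ν * f z.1 (z.2 + (α - (ν : ℝ)) * h)‖ₑ
            ∂periodSq := lintegral_mono fun z => enorm_tsum_le_tsum_enorm
      _ = ∑' ν : ℕ, ‖fracBinom α ν‖ₑ * ∫⁻ z, ‖f z.1 z.2‖ₑ ∂periodSq := by
          rw [lintegral_tsum fun ν => ((hf.measurable_shift _).const_mul _).enorm.aemeasurable]
          refine tsum_congr fun ν => ?_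
          rw [← hf.lintegral_shift ((α - (ν : ℝ)) * h),
            ← lintegral_const_mul _ (hf.measurable_shift _).enorm]
          refine lintegral_congr fun z => ?_
          rw [enorm_mul, enorm_mul]
          simp
      _ < ⊤ := by
          rw [ENNReal.tsum_mul_right]
          refine ENNReal.mul_lt_top ?_ hf.lintegral_lt_top
          have := (summable_abs_fracBinom hα).tsum_ofReal_lt_top
          simpa only [← Real.norm_eq_abs, ofReal_norm] using this

lemma PeriodicIntegrable.coef2_diffY {f : ℝ → ℝ → ℝ} (hf : PeriodicIntegrable f) {α : ℝ}
    (hα : 0 < α) (h : ℝ) (k : ℤ × ℤ) :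
    coef2 (toPlane (_root_.diffY α h f)) k = diffSymbol α (k.2 * h) * coef2 (toPlane f) k := by
  set a : ℕ → ℝ := fun ν => (-1 : ℝ) ^ ν * fracBinom α ν with ha
  set Φ : ℕ → ℝ × ℝ → ℂ := fun ν z =>
    (a ν : ℂ) * ((f z.1 (z.2 + (α - (ν : ℝ)) * h) : ℂ) * char2 (-k) z) with hΦ
  have hbase : ∀ ν : ℕ, Integrable (fun z : ℝ × ℝ =>
      (f z.1 (z.2 + (α - (ν : ℝ)) * h) : ℂ) * char2 (-k) z) periodSq := fun ν =>
    integrable_mul_char2 (hf.integrable_shift _).ofReal _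
  have hnorm : ∀ ν, ∫ z, ‖Φ ν z‖ ∂periodSq =
      |fracBinom α ν| * ∫ z, ‖f z.1 z.2‖ ∂periodSq := fun ν => by
    have h1 : ∀ z, ‖Φ ν z‖ = |fracBinom α ν| * ‖f z.1 (z.2 + (α - (ν : ℝ)) * h)‖ := fun z => by
      rw [hΦ]
      simp only [norm_mul, norm_char2, mul_one, Complex.norm_real, Real.norm_eq_abs, ha,
        abs_pow, abs_neg, abs_one, one_pow, one_mul]
    simp_rw [h1]
    rw [integral_const_mul, integral_norm_eq_lintegral_enorm, hf.lintegral_shift,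
      ← integral_norm_eq_lintegral_enorm]
    · exact hf.meas.aestronglyMeasurable
    · exact (hf.measurable_shift _).aestronglyMeasurable
  have hs := hasSum_integral_of_summable_integral_norm (μ := periodSq) (F := Φ)
    (fun ν => (hbase ν).const_mul _) (by
      simp_rw [hnorm]; exact (summable_abs_fracBinom hα).mul_right _)
  have h2 : ∀ z, ∑' ν, Φ ν z = toPlane (_root_.diffY α h f) z * char2 (-k) z := fun z => by
    rw [hΦ, toPlane, _root_.diffY, Complex.ofReal_tsum, ← tsum_mul_right]
    refine tsum_congr fun ν => ?_
    simp only [ha]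
    push_cast
    ring
  simp_rw [h2] at hs
  rw [coef2, ← hs.tsum_eq, diffSymbol, ← tsum_mul_right]
  refine tsum_congr fun ν => ?_
  rw [hΦ]
  simp only
  rw [integral_const_mul, hf.integral_shift, ← mul_assoc]
  congr 4
  push_cast; ring

lemma measurePreserving_swap_periodSq : MeasurePreserving Prod.swap periodSq periodSq :=
  Measure.measurePreserving_swap

lemma PeriodicIntegrable.flip {f : ℝ → ℝ → ℝ} (hf : PeriodicIntegrable f) :
    PeriodicIntegrable (flip f) where
  meas := hf.meas.comp measurable_swap
  periodic_x y := hf.periodic_y y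
  periodic_y x := hf.periodic_x x
  integrable := measurePreserving_swap_periodSq.integrable_comp_of_integrable hf.integrable

lemma coef2_flip (f : ℝ → ℝ → ℝ) (k : ℤ × ℤ) :
    coef2 (toPlane (flip f)) k = coef2 (toPlane f) k.swap := by
  rw [coef2, coef2, ← measurePreserving_swap_periodSq.integral_comp
    (MeasurableEquiv.prodComm (α := ℝ) (β := ℝ)).measurableEmbedding]
  refine integral_congr_ae (Filter.Eventually.of_forall fun z => ?_)
  simp only [toPlane, flip, char2, Prod.fst_swap, Prod.snd_swap, Prod.fst_neg, Prod.snd_neg]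
  congr 2
  ring

lemma diffX_eq_flip (α h : ℝ) (f : ℝ → ℝ → ℝ) : diffX α h f = flip (diffY α h (flip f)) := rfl

lemma PeriodicIntegrable.diffX {f : ℝ → ℝ → ℝ} (hf : PeriodicIntegrable f) {α : ℝ} (hα : 0 < α)
    (h : ℝ) : PeriodicIntegrable (diffX α h f) := by
  rw [diffX_eq_flip]; exact (hf.flip.diffY hα h).flip

lemma PeriodicIntegrable.coef2_diffX {f : ℝ → ℝ → ℝ} (hf : PeriodicIntegrable f) {α : ℝ}
    (hα : 0 < α) (h : ℝ) (k : ℤ × ℤ) :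
    coef2 (toPlane (_root_.diffX α h f)) k = diffSymbol α (k.1 * h) * coef2 (toPlane f) k := by
  rw [diffX_eq_flip, coef2_flip, hf.flip.coef2_diffY hα, coef2_flip, Prod.swap_swap,
    Prod.snd_swap]

lemma Lp2Norm_eq_eLpNorm {p : ℝ} (hp : 0 < p) {f : ℝ → ℝ → ℝ}
    (hf : Measurable (Function.uncurry f)) :
    Lp2Norm p f = eLpNorm (toPlane f) (ENNReal.ofReal p) periodSq := by
  have h0 : Measurable fun z : ℝ × ℝ => f z.1 z.2 := hf
  rw [eLpNorm_eq_lintegral_rpow_enorm_toReal (by simpa using hp) ENNReal.ofReal_ne_top,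
    ENNReal.toReal_ofReal hp.le, Lp2Norm, periodSq, lintegral_prod]
  · congr 1
    refine lintegral_congr fun x => lintegral_congr fun y => ?_
    rw [toPlane, ← ofReal_norm, Complex.norm_real, Real.norm_eq_abs,
      ENNReal.ofReal_rpow_of_nonneg (abs_nonneg _) hp.le]
  · exact ((Complex.measurable_ofReal.comp h0).enorm.pow_const p).aemeasurable

lemma MemLp0.periodicIntegrable {p : ℝ} (hp : 1 ≤ p) {f : ℝ → ℝ → ℝ} (hf : MemLp0 p f) :
    PeriodicIntegrable f where
  meas := hf.meas
  periodic_x := hf.periodic_x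
  periodic_y := hf.periodic_y
  integrable := by
    have h0 : Measurable fun z : ℝ × ℝ => f z.1 z.2 := hf.meas
    have h1 : MemLp (toPlane f) (ENNReal.ofReal p) periodSq := by
      refine ⟨(Complex.measurable_ofReal.comp h0).aestronglyMeasurable, ?_⟩
      rw [← Lp2Norm_eq_eLpNorm (by linarith) hf.meas]
      exact hf.norm_ne_top.lt_top
    exact (h1.integrable (by
      rw [← ENNReal.ofReal_one]; exact ENNReal.ofReal_le_ofReal hp)).re

lemma intervalIntegral_prod_eq {E : Type*} [NormedAddCommGroup E] [NormedSpace ℝ E]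
    {u : ℝ → ℝ → E} (hu : Integrable (fun z : ℝ × ℝ => u z.1 z.2) periodSq) :
    ∫ x in (0:ℝ)..(2*π), ∫ y in (0:ℝ)..(2*π), u x y = ∫ z, u z.1 z.2 ∂periodSq := by
  have hpi : (0:ℝ) ≤ 2*π := by positivity
  rw [periodSq] at hu ⊢
  rw [integral_prod _ hu, intervalIntegral.integral_of_le hpi]
  simp_rw [intervalIntegral.integral_of_le hpi]

lemma PeriodicIntegrable.fourierCoefZ_eq {f : ℝ → ℝ → ℝ} (hf : PeriodicIntegrable f) (m n : ℤ) :
    fourierCoefZ f m n = (((2*π)^2)⁻¹ : ℝ) * coef2 (toPlane f) (m, n) := by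
  have h : ∀ x y : ℝ, (f x y : ℂ) *
      Complex.exp (-Complex.I * ((m : ℂ) * (x : ℂ) + (n : ℂ) * (y : ℂ))) =
      toPlane f (x, y) * char2 (-(m, n)) (x, y) := fun x y => by
    rw [toPlane, char2]
    congr 2
    simp; ring
  rw [fourierCoefZ]
  simp_rw [h]
  rw [intervalIntegral_prod_eq (u := fun x y => toPlane f (x, y) * char2 (-(m, n)) (x, y))
    (integrable_mul_char2 hf.integrable_toPlane _), coef2]

lemma exists_sin_int_mul (m : ℤ) : ∃ ε : ℝ, ∀ x : ℝ,
    Real.sin (m * x) = ε * Real.sin ((m.natAbs : ℝ) * x) ∧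
      Real.cos (m * x) = Real.cos ((m.natAbs : ℝ) * x) := by
  rcases Int.natAbs_eq m with h | h
  · refine ⟨1, fun x => ?_⟩
    have : (m : ℝ) = (m.natAbs : ℝ) := by
      rw [← Int.cast_natCast (R := ℝ), ← h]
    rw [this]; simp
  · refine ⟨-1, fun x => ?_⟩
    have : (m : ℝ) = -(m.natAbs : ℝ) := by
      rw [← Int.cast_natCast (R := ℝ), ← Int.cast_neg, ← h]
    rw [this, neg_mul, Real.sin_neg, Real.cos_neg]; simp

lemma PeriodicIntegrable.integrable_mul {f : ℝ → ℝ → ℝ} (hf : PeriodicIntegrable f)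
    {u v : ℝ → ℝ} (hu : Continuous u) (hv : Continuous v) (hu1 : ∀ x, |u x| ≤ 1)
    (hv1 : ∀ x, |v x| ≤ 1) :
    Integrable (fun z : ℝ × ℝ => f z.1 z.2 * u z.1 * v z.2) periodSq := by
  have h1 := hf.integrable.mul_bdd (c := 1) (g := fun z : ℝ × ℝ => u z.1)
    (hu.comp continuous_fst).aestronglyMeasurable (Filter.Eventually.of_forall fun z => hu1 _)
  exact h1.mul_bdd (c := 1) (g := fun z : ℝ × ℝ => v z.2)
    (hv.comp continuous_snd).aestronglyMeasurable (Filter.Eventually.of_forall fun z => hv1 _)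

/-- The complex Fourier coefficients in terms of the trigonometric ones. -/
lemma PeriodicIntegrable.exists_coef2_eq {f : ℝ → ℝ → ℝ} (hf : PeriodicIntegrable f)
    (k : ℤ × ℤ) : ∃ ε ε' : ℝ, coef2 (toPlane f) k = π ^ 2 *
      (fourierCC f k.1.natAbs k.2.natAbs - Complex.I * ε' * fourierCS f k.1.natAbs k.2.natAbs -
        Complex.I * ε * fourierSC f k.1.natAbs k.2.natAbs -
        ε * ε' * fourierSS f k.1.natAbs k.2.natAbs) := by
  obtain ⟨ε, hε⟩ := exists_sin_int_mul k.1
  obtain ⟨ε', hε'⟩ := exists_sin_int_mul k.2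
  refine ⟨ε, ε', ?_⟩
  set a : ℝ := (k.1.natAbs : ℝ) with ha
  set b : ℝ := (k.2.natAbs : ℝ) with hb
  have hc : ∀ a : ℝ, Continuous fun x : ℝ => Real.cos (a * x) := fun a => by fun_prop
  have hs : ∀ a : ℝ, Continuous fun x : ℝ => Real.sin (a * x) := fun a => by fun_prop
  have iCC := hf.integrable_mul (hc a) (hc b) (fun _ => abs_cos_le_one _) fun _ => abs_cos_le_one _
  have iSC := hf.integrable_mul (hs a) (hc b) (fun _ => abs_sin_le_one _) fun _ => abs_cos_le_one _
  have iCS := hf.integrable_mul (hc a) (hs b) (fun _ => abs_cos_le_one _) fun _ => abs_sin_le_one _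
  have iSS := hf.integrable_mul (hs a) (hs b) (fun _ => abs_sin_le_one _) fun _ => abs_sin_le_one _
  have hexp : ∀ z, toPlane f z * char2 (-k) z =
      ((f z.1 z.2 * Real.cos (a * z.1) * Real.cos (b * z.2) : ℝ) : ℂ) -
      Complex.I * ε' * ((f z.1 z.2 * Real.cos (a * z.1) * Real.sin (b * z.2) : ℝ) : ℂ) -
      Complex.I * ε * ((f z.1 z.2 * Real.sin (a * z.1) * Real.cos (b * z.2) : ℝ) : ℂ) -
      ε * ε' * ((f z.1 z.2 * Real.sin (a * z.1) * Real.sin (b * z.2) : ℝ) : ℂ) := fun z => by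
    have e1 : char2 (-k) z = Complex.exp (-((k.1 * z.1 : ℝ) : ℂ) * Complex.I) *
        Complex.exp (-((k.2 * z.2 : ℝ) : ℂ) * Complex.I) := by
      rw [char2, ← Complex.exp_add]; congr 1; simp; ring
    rw [e1, Complex.exp_mul_I, Complex.exp_mul_I, Complex.cos_neg, Complex.sin_neg,
      Complex.cos_neg, Complex.sin_neg, ← Complex.ofReal_cos, ← Complex.ofReal_sin,
      ← Complex.ofReal_cos, ← Complex.ofReal_sin, (hε z.1).1, (hε z.1).2, (hε' z.2).1,
      (hε' z.2).2, toPlane]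
    push_cast
    linear_combination ((f z.1 z.2 : ℂ) * ε * ε' * Complex.sin (a * z.1) *
      Complex.sin (b * z.2)) * Complex.I_sq
  have hpi : (π : ℂ) ≠ 0 := by simp [Real.pi_ne_zero]
  rw [coef2]
  simp_rw [hexp]
  rw [integral_sub, integral_sub, integral_sub, integral_const_mul, integral_const_mul,
    integral_const_mul, integral_complex_ofReal, integral_complex_ofReal, integral_complex_ofReal,
    integral_complex_ofReal,
    fourierCC, fourierSC, fourierCS, fourierSS, intervalIntegral_prod_eq iCC,
    intervalIntegral_prod_eq iCS, intervalIntegral_prod_eq iSC, intervalIntegral_prod_eq iSS]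
  · simp only [ha, hb]
    push_cast
    field_simp
  · exact iCC.ofReal
  · exact iCS.ofReal.const_mul _
  · exact iCC.ofReal.sub (iCS.ofReal.const_mul _)
  · exact iSC.ofReal.const_mul _
  · exact (iCC.ofReal.sub (iCS.ofReal.const_mul _)).sub (iSC.ofReal.const_mul _)
  · exact iSS.ofReal.const_mul _

lemma InLambdaClass.coef2_eq_zero {p : ℝ} (hp : 1 ≤ p) {f : ℝ → ℝ → ℝ} {lam : ℕ → ℕ → ℝ}
    (hf : InLambdaClass p f lam) {k : ℤ × ℤ} (hk : k ∉ dyadicFreq) :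
    coef2 (toPlane f) k = 0 := by
  obtain ⟨ε, ε', h⟩ := (hf.1.periodicIntegrable hp).exists_coef2_eq k
  obtain ⟨h1, h2, h3⟩ := hf.2.2.2 k.1.natAbs k.2.natAbs
  rw [h, h1, h2, h3, hf.2.2.1 _ _ fun ⟨μ, ν, h1, h2⟩ => hk ⟨⟨μ, h1⟩, ν, h2⟩]
  simp

lemma continuous_abs_two_sin_rpow {a : ℝ} (ha : 0 ≤ a) (N : ℝ) :
    Continuous fun h : ℝ => |2 * Real.sin (N * h / 2)| ^ a :=
  (by fun_prop : Continuous fun h : ℝ => |2 * Real.sin (N * h / 2)|).rpow_const fun _ => Or.inr ha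

lemma integral_sin_sq_ge {N δ : ℝ} (hN : 0 < N) (hδ : 0 < δ) (hT : π ≤ N * δ) :
    δ / 4 ≤ ∫ h in (0:ℝ)..δ, Real.sin (N * h / 2) ^ 2 := by
  have h1 : ∀ h : ℝ, Real.sin (N * h / 2) ^ 2 = 1 / 2 - Real.cos (N * h) / 2 := fun h => by
    rw [Real.sin_sq_eq_half_sub]; ring_nf
  simp_rw [h1]
  rw [intervalIntegral.integral_sub (by simp)
    ((by fun_prop : Continuous fun h : ℝ => Real.cos (N * h) / 2).intervalIntegrable _ _),
    intervalIntegral.integral_div (f := fun h => Real.cos (N * h)),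
    intervalIntegral.integral_comp_mul_left _ hN.ne', integral_cos]
  simp only [intervalIntegral.integral_const, smul_eq_mul, mul_zero, Real.sin_zero, sub_zero]
  have h2 : N⁻¹ * Real.sin (N * δ) ≤ N⁻¹ * 1 := by gcongr; exact Real.sin_le_one _
  have h3 : N⁻¹ ≤ δ / 3 := by
    rw [inv_le_iff_one_le_mul₀ hN]
    nlinarith [Real.pi_gt_three]
  linarith

/-- The average of `|2 sin (N h / 2)| ^ (2 α)` over `0 < h < δ` is at least of the order of its
maximum. -/
lemma exists_le_integral_abs_two_sin_rpow {α : ℝ} (hα : 0 < α) : ∃ c : ℝ, 0 < c ∧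
    ∀ N δ : ℝ, 0 < N → 0 < δ →
      c * δ * min 1 (N * δ) ^ (2 * α) ≤ ∫ h in (0:ℝ)..δ, |2 * Real.sin (N * h / 2)| ^ (2 * α) := by
  have hα2 : 0 ≤ 2 * α := by positivity
  refine ⟨min ((1/π) ^ (2*α) / 2) ((1/8) ^ α / 8), by positivity, fun N δ hN hδ => ?_⟩
  have hFint : ∀ a b, IntervalIntegrable
      (fun h => |2 * Real.sin (N * h / 2)| ^ (2 * α)) volume a b :=
    fun a b => (continuous_abs_two_sin_rpow hα2 N).intervalIntegrable a b
  have hmin0 : 0 ≤ min 1 (N * δ) := by positivity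
  rcases le_total (N * δ) π with hT | hT
  · have h1 : ∀ h ∈ Set.Icc (δ/2) δ, (1/π * min 1 (N * δ)) ^ (2*α) ≤
        |2 * Real.sin (N * h / 2)| ^ (2 * α) := fun h hh => by
      have hh0 : 0 < h := by linarith [hh.1]
      have hNh : N * h ≤ N * δ := by gcongr; exact hh.2
      have hNh2 : N * (δ / 2) ≤ N * h := by gcongr; exact hh.1
      have hsin := Real.mul_le_sin (x := N * h / 2) (by positivity) (by linarith)
      refine Real.rpow_le_rpow (by positivity) ?_ hα2
      refine le_trans ?_ (le_abs_self _)
      calc 1 / π * min 1 (N * δ) ≤ 1 / π * (N * δ) := by gcongr; exact min_le_right _ _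
        _ ≤ 1 / π * (2 * (N * h)) :=
            mul_le_mul_of_nonneg_left (by linarith) (by positivity)
        _ = 2 * (2 / π * (N * h / 2)) := by ring
        _ ≤ _ := by gcongr
    calc _ ≤ (1/π) ^ (2*α) / 2 * δ * min 1 (N * δ) ^ (2 * α) := by
          gcongr; exact min_le_left _ _
      _ = ∫ _ in (δ/2)..δ, (1/π * min 1 (N * δ)) ^ (2*α) := by
          rw [intervalIntegral.integral_const, smul_eq_mul, Real.mul_rpow (by positivity) hmin0]
          ring
      _ ≤ ∫ h in (δ/2)..δ, |2 * Real.sin (N * h / 2)| ^ (2 * α) :=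
          intervalIntegral.integral_mono_on (by linarith) (by simp) (hFint _ _) h1
      _ ≤ _ := by
          rw [← intervalIntegral.integral_add_adjacent_intervals (hFint 0 (δ/2)) (hFint (δ/2) δ)]
          have : 0 ≤ ∫ h in (0:ℝ)..(δ/2), |2 * Real.sin (N * h / 2)| ^ (2 * α) :=
            intervalIntegral.integral_nonneg (by linarith) fun _ _ => by positivity
          linarith
  · have h1 : ∀ h : ℝ, (1/8) ^ α * (Real.sin (N * h / 2) ^ 2 - 1/8) ≤
        |2 * Real.sin (N * h / 2)| ^ (2 * α) := fun h => by
      set Y := Real.sin (N * h / 2) ^ 2 with hY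
      have hY1 : Y ≤ 1 := Real.sin_sq_le_one _
      have hY2 : Y ^ α ≤ |2 * Real.sin (N * h / 2)| ^ (2 * α) := by
        rw [Real.rpow_mul (abs_nonneg _), Real.rpow_two, sq_abs]
        refine Real.rpow_le_rpow (sq_nonneg _) ?_ hα.le
        nlinarith [sq_nonneg (Real.sin (N * h / 2))]
      rcases le_total Y (1/8) with h8 | h8
      · refine le_trans (mul_nonpos_of_nonneg_of_nonpos (by positivity) (by linarith)) ?_
        positivity
      · refine le_trans ?_ hY2
        calc (1/8 : ℝ) ^ α * (Y - 1/8) ≤ (1/8) ^ α * 1 := by gcongr; linarith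
          _ ≤ Y ^ α := by rw [mul_one]; exact Real.rpow_le_rpow (by norm_num) h8 hα.le
    have h2 := integral_sin_sq_ge hN hδ hT
    have hc : IntervalIntegrable (fun h => Real.sin (N * h / 2) ^ 2) volume 0 δ :=
      (by fun_prop : Continuous fun h : ℝ => Real.sin (N * h / 2) ^ 2).intervalIntegrable _ _
    calc _ ≤ (1/8) ^ α / 8 * δ * 1 ^ (2 * α) := by
          gcongr
          · exact min_le_right _ _
          · exact min_le_left _ _
      _ = (1/8) ^ α * (δ / 4 - δ * (1/8)) := by rw [Real.one_rpow]; ring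
      _ ≤ (1/8) ^ α * ((∫ h in (0:ℝ)..δ, Real.sin (N * h / 2) ^ 2) - δ * (1/8)) := by gcongr
      _ = ∫ h in (0:ℝ)..δ, (1/8) ^ α * (Real.sin (N * h / 2) ^ 2 - 1/8) := by
          rw [intervalIntegral.integral_const_mul, intervalIntegral.integral_sub hc (by simp)]
          simp
      _ ≤ _ := intervalIntegral.integral_mono_on hδ.le ((hc.sub (by simp)).const_mul _) (hFint _ _)
          fun h _ => h1 h

/-- `min (1, |m| δ)`, the size of the symbol of a first difference maximised over steps
`|h| ≤ δ`. -/
def freqMin (m : ℤ) (δ : ℝ) : ℝ := min 1 (|(m : ℝ)| * δ)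

lemma freqMin_nonneg (m : ℤ) {δ : ℝ} (hδ : 0 ≤ δ) : 0 ≤ freqMin m δ := by
  unfold freqMin; positivity

lemma norm_diffSymbol_le {α : ℝ} (hα : 0 < α) (m : ℤ) {h δ : ℝ} (hh : |h| ≤ δ) :
    ‖diffSymbol α (m * h)‖ ≤ (2 * freqMin m δ) ^ α := by
  rw [norm_diffSymbol hα]
  refine Real.rpow_le_rpow (abs_nonneg _) ?_ hα.le
  rw [abs_mul, abs_two, freqMin]
  gcongr
  refine le_min (Real.abs_sin_le_one _) ?_
  have h1 : |Real.sin (m * h / 2)| ≤ |m * h / 2| := Real.abs_sin_le_abs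
  refine h1.trans ?_
  rw [abs_div, abs_mul, abs_two]
  have : |(m : ℝ)| * |h| ≤ |(m : ℝ)| * δ := by gcongr
  have : 0 ≤ |(m : ℝ)| * |h| := by positivity
  linarith

lemma enorm_diffSymbol_sq {α : ℝ} (hα : 0 < α) (m : ℤ) (h : ℝ) :
    ‖diffSymbol α (m * h)‖ₑ ^ 2 =
      ENNReal.ofReal (|2 * Real.sin (|(m : ℝ)| * h / 2)| ^ (2 * α)) := by
  have h1 : |2 * Real.sin (|(m : ℝ)| * h / 2)| = |2 * Real.sin (m * h / 2)| := by
    rcases abs_choice (m : ℝ) with h | h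
    · rw [h]
    · rw [h, neg_mul, neg_div, Real.sin_neg, mul_neg, abs_neg]
  rw [← ofReal_norm, ← ENNReal.ofReal_pow (norm_nonneg _), norm_diffSymbol hα, h1, mul_comm 2 α,
    Real.rpow_mul (abs_nonneg _), Real.rpow_two]

lemma enorm_diffSymbol_sq_le {α : ℝ} (hα : 0 < α) (m : ℤ) {h δ : ℝ} (hh : |h| ≤ δ) :
    ‖diffSymbol α (m * h)‖ₑ ^ 2 ≤
      ENNReal.ofReal (2 ^ (2 * α)) * ENNReal.ofReal (freqMin m δ ^ (2 * α)) := by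
  have hδ : 0 ≤ δ := (abs_nonneg h).trans hh
  rw [← ofReal_norm, ← ENNReal.ofReal_pow (norm_nonneg _), ← ENNReal.ofReal_mul (by positivity),
    ← Real.mul_rpow (by norm_num) (freqMin_nonneg m hδ), mul_comm 2 α,
    Real.rpow_mul (by have := freqMin_nonneg m hδ; positivity), Real.rpow_two]
  exact ENNReal.ofReal_le_ofReal (by gcongr; exact norm_diffSymbol_le hα m hh)

lemma measurable_enorm_diffSymbol_sq {α : ℝ} (hα : 0 < α) (m : ℤ) :
    Measurable fun h : ℝ => ‖diffSymbol α (m * h)‖ₑ ^ 2 := by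
  simp_rw [enorm_diffSymbol_sq hα]
  exact (continuous_abs_two_sin_rpow (by positivity) _).measurable.ennreal_ofReal

lemma exists_le_lintegral_diffSymbol {α : ℝ} (hα : 0 < α) : ∃ c : ℝ, 0 < c ∧
    ∀ (m : ℤ) (δ : ℝ), 0 < δ → ENNReal.ofReal (c * δ) * ENNReal.ofReal (freqMin m δ ^ (2 * α)) ≤
      ∫⁻ h in Set.Ioc 0 δ, ‖diffSymbol α (m * h)‖ₑ ^ 2 := by
  obtain ⟨c, hc, H⟩ := exists_le_integral_abs_two_sin_rpow hα
  refine ⟨c, hc, fun m δ hδ => ?_⟩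
  rcases eq_or_ne m 0 with rfl | hm
  · simp only [freqMin, Int.cast_zero, abs_zero, zero_mul, zero_le_one, min_eq_right]
    rw [Real.zero_rpow (by positivity)]
    simp
  have hm' : 0 < |(m : ℝ)| := by simpa using hm
  have hcont := continuous_abs_two_sin_rpow (a := 2 * α) (by positivity) |(m : ℝ)|
  simp_rw [enorm_diffSymbol_sq hα]
  rw [← ENNReal.ofReal_mul (by positivity), ← ofReal_integral_eq_lintegral_ofReal
    ((hcont.integrableOn_Icc).mono_set Set.Ioc_subset_Icc_self)
    (Filter.Eventually.of_forall fun _ => by positivity),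
    ← intervalIntegral.integral_of_le hδ.le]
  exact ENNReal.ofReal_le_ofReal (H _ δ hm' hδ)

lemma lintegral_Ioo_rpow {a s : ℝ} (ha : 0 < a) (hs : 0 < s) :
    ∫⁻ t in Set.Ioo 0 s, ENNReal.ofReal (t ^ (a - 1)) = ENNReal.ofReal (s ^ a / a) := by
  rw [← ofReal_integral_eq_lintegral_ofReal]
  · rw [← integral_Ioc_eq_integral_Ioo, ← intervalIntegral.integral_of_le hs.le,
      integral_rpow (Or.inl (by linarith)), sub_add_cancel, Real.zero_rpow ha.ne', sub_zero]
  · have := intervalIntegral.intervalIntegrable_rpow' (a := 0) (b := s) (r := a - 1) (by linarith)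
    rw [intervalIntegrable_iff_integrableOn_Ioo_of_le hs.le] at this
    exact this
  · filter_upwards [ae_restrict_mem measurableSet_Ioo] with t ht
    exact Real.rpow_nonneg ht.1.le _

lemma lintegral_Ioi_rpow {a s : ℝ} (ha : 0 < a) (hs : 0 < s) :
    ∫⁻ t in Set.Ioi s, ENNReal.ofReal (t ^ (-a - 1)) = ENNReal.ofReal (s ^ (-a) / a) := by
  rw [← ofReal_integral_eq_lintegral_ofReal (integrableOn_Ioi_rpow_of_lt (by linarith) hs),
    integral_Ioi_rpow_of_lt (by linarith) hs, sub_add_cancel, neg_div_neg_eq]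
  filter_upwards [ae_restrict_mem measurableSet_Ioi] with t ht
  exact Real.rpow_nonneg (hs.trans ht).le _

lemma rpow_mul_min_eq {N t r β : ℝ} (hN : 0 < N) (ht : 0 < t) (hNt : N * t ≤ 1) :
    t ^ (-r*2-1) * min 1 (N * t) ^ (2 * (r + β)) =
      N ^ (2 * r) * N ^ (2 * β) * t ^ (2 * β - 1) := by
  rw [min_eq_right hNt, Real.mul_rpow hN.le ht.le, ← Real.rpow_add hN,
    show 2 * β - 1 = (-r*2-1) + 2 * (r + β) by ring, Real.rpow_add ht, mul_add]
  ring

lemma lintegral_rpow_mul_min_of_le {N s r β : ℝ} (hN : 0 < N) (hs : 0 < s) (hβ : 0 < β)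
    (hNs : N * s ≤ 1) :
    ∫⁻ t in Set.Ioo 0 s, ENNReal.ofReal (t ^ (-r*2-1) * min 1 (N * t) ^ (2 * (r + β))) =
      ENNReal.ofReal (N ^ (2 * r) * (N * s) ^ (2 * β) / (2 * β)) := by
  have h : ∀ t ∈ Set.Ioo 0 s, ENNReal.ofReal (t ^ (-r*2-1) * min 1 (N * t) ^ (2 * (r + β))) =
      ENNReal.ofReal (N ^ (2 * r) * N ^ (2 * β)) * ENNReal.ofReal (t ^ (2 * β - 1)) := fun t ht => by
    have : N * t ≤ N * s := by gcongr; exact ht.2.le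
    rw [rpow_mul_min_eq hN ht.1 (by linarith), ENNReal.ofReal_mul (by positivity)]
  rw [setLIntegral_congr_fun measurableSet_Ioo h, lintegral_const_mul' _ _ ENNReal.ofReal_ne_top,
    lintegral_Ioo_rpow (by positivity) hs, ← ENNReal.ofReal_mul (by positivity),
    Real.mul_rpow hN.le hs.le]
  congr 1
  ring

/-- The one-dimensional weighted integral of `min (1, N t) ^ (2 (r + β))`. -/
lemma lintegral_rpow_mul_min_bounds {N δ r β : ℝ} (hN : 0 < N) (hδ : 0 < δ) (hr : 0 < r)
    (hβ : 0 < β) :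
    ENNReal.ofReal (1 / (2 * β)) * ENNReal.ofReal (N ^ (2 * r) * min 1 (N * δ) ^ (2 * β)) ≤
      ∫⁻ t in Set.Ioo 0 δ, ENNReal.ofReal (t ^ (-r*2-1) * min 1 (N * t) ^ (2 * (r + β))) ∧
    ∫⁻ t in Set.Ioo 0 δ, ENNReal.ofReal (t ^ (-r*2-1) * min 1 (N * t) ^ (2 * (r + β))) ≤
      ENNReal.ofReal (1 / (2 * β) + 1 / (2 * r)) *
        ENNReal.ofReal (N ^ (2 * r) * min 1 (N * δ) ^ (2 * β)) := by
  rw [← ENNReal.ofReal_mul (by positivity), ← ENNReal.ofReal_mul (by positivity)]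
  rcases le_total (N * δ) 1 with h | h
  · rw [lintegral_rpow_mul_min_of_le hN hδ hβ h, min_eq_right h]
    constructor
    · exact ENNReal.ofReal_le_ofReal (le_of_eq (by ring))
    · refine ENNReal.ofReal_le_ofReal ?_
      rw [add_mul, one_div_mul_eq_div]
      have : 0 ≤ 1 / (2 * r) * (N ^ (2 * r) * (N * δ) ^ (2 * β)) := by positivity
      linarith
  · have hNN : N * (1 / N) = 1 := by field_simp
    have hle : 1 / N ≤ δ := by rw [div_le_iff₀ hN]; linarith
    have h1 := lintegral_rpow_mul_min_of_le (r := r) hN (one_div_pos.2 hN) hβ hNN.le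
    rw [hNN, Real.one_rpow, mul_one] at h1
    rw [min_eq_left h, Real.one_rpow, mul_one]
    constructor
    · rw [one_div_mul_eq_div, ← h1]
      exact lintegral_mono_set (Set.Ioo_subset_Ioo_right hle)
    · have hsub : Set.Ioo 0 δ ⊆ Set.Ioo 0 (1 / N) ∪ Set.Ici (1 / N) := fun t ht => by
        rcases lt_or_ge t (1 / N) with h | h
        · exact Or.inl ⟨ht.1, h⟩
        · exact Or.inr h
      refine (lintegral_mono_set hsub).trans ((lintegral_union_le _ _ _).trans ?_)
      rw [h1, add_mul, one_div_mul_eq_div, one_div_mul_eq_div,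
        ENNReal.ofReal_add (by positivity) (by positivity)]
      gcongr
      rw [setLIntegral_congr (Ioi_ae_eq_Ici (a := 1 / N)).symm]
      have h2 := lintegral_Ioi_rpow (a := 2 * r) (s := 1 / N) (by positivity) (by positivity)
      rw [one_div, Real.inv_rpow hN.le, Real.rpow_neg hN.le, inv_inv] at h2
      rw [one_div, ← h2]
      refine setLIntegral_mono' measurableSet_Ioi fun t ht => ENNReal.ofReal_le_ofReal ?_
      have ht0 : 0 < t := (inv_pos.2 hN).trans ht
      rw [show -r*2-1 = -(2*r)-1 by ring]
      refine mul_le_of_le_one_right (by positivity) ?_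
      exact Real.rpow_le_one (by positivity) (min_le_left _ _) (by positivity)

lemma lintegral_lintegral_tsum_mul {ι : Type*} [Countable ι] (μ ν : Measure ℝ)
    {u v : ι → ℝ → ℝ≥0∞} (hu : ∀ k, Measurable (u k)) (hv : ∀ k, Measurable (v k))
    (a : ι → ℝ≥0∞) : ∫⁻ x, ∫⁻ y, ∑' k, u k x * v k y * a k ∂ν ∂μ =
      ∑' k, (∫⁻ x, u k x ∂μ) * (∫⁻ y, v k y ∂ν) * a k := by
  have h1 : ∀ x, ∫⁻ y, ∑' k, u k x * v k y * a k ∂ν = ∑' k, u k x * ((∫⁻ y, v k y ∂ν) * a k) :=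
      fun x => by
    rw [lintegral_tsum fun k => (((hv k).const_mul _).mul_const _).aemeasurable]
    refine tsum_congr fun k => ?_
    rw [lintegral_mul_const _ ((hv k).const_mul _), lintegral_const_mul _ (hv k), mul_assoc]
  simp_rw [h1]
  rw [lintegral_tsum fun k => ((hu k).mul_const _).aemeasurable]
  refine tsum_congr fun k => ?_
  rw [lintegral_mul_const _ (hu k), mul_assoc]

/-- The weighted square sum of Fourier coefficients which is equivalent to the square of the mixed
modulus of smoothness. -/
def modSum (α₁ α₂ δ₁ δ₂ : ℝ) (F : ℝ × ℝ → ℂ) : ℝ≥0∞ :=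
  ∑' k : ℤ × ℤ, ENNReal.ofReal (freqMin k.1 δ₁ ^ (2 * α₁)) *
    ENNReal.ofReal (freqMin k.2 δ₂ ^ (2 * α₂)) * ‖coef2 F k‖ₑ ^ 2

section Differences

variable {α₁ α₂ : ℝ} {f : ℝ → ℝ → ℝ}

lemma PeriodicIntegrable.coef2_diffX_diffY (hf : PeriodicIntegrable f) (hα₁ : 0 < α₁)
    (hα₂ : 0 < α₂) (h₁ h₂ : ℝ) (k : ℤ × ℤ) :
    coef2 (toPlane (_root_.diffX α₁ h₁ (_root_.diffY α₂ h₂ f))) k =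
      diffSymbol α₁ (k.1 * h₁) * diffSymbol α₂ (k.2 * h₂) * coef2 (toPlane f) k := by
  rw [(hf.diffY hα₂ h₂).coef2_diffX hα₁, hf.coef2_diffY hα₂, mul_assoc]

lemma PeriodicIntegrable.coefSq_diffX_diffY (hf : PeriodicIntegrable f) (hα₁ : 0 < α₁)
    (hα₂ : 0 < α₂) (h₁ h₂ : ℝ) :
    coefSq (toPlane (_root_.diffX α₁ h₁ (_root_.diffY α₂ h₂ f))) =
      ∑' k : ℤ × ℤ, ‖diffSymbol α₁ (k.1 * h₁)‖ₑ ^ 2 * ‖diffSymbol α₂ (k.2 * h₂)‖ₑ ^ 2 *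
        ‖coef2 (toPlane f) k‖ₑ ^ 2 := by
  refine tsum_congr fun k => ?_
  rw [hf.coef2_diffX_diffY hα₁ hα₂, enorm_mul, enorm_mul, mul_pow, mul_pow]

end Differences

lemma exists_mixedMod_sq_le {p α₁ α₂ : ℝ} (hp : 1 < p) (hα₁ : 0 < α₁) (hα₂ : 0 < α₂) :
    ∃ C : ℝ, 0 < C ∧ ∀ f : ℝ → ℝ → ℝ, PeriodicIntegrable f →
      (∀ k ∉ dyadicFreq, coef2 (toPlane f) k = 0) → ∀ δ₁ δ₂ : ℝ,
        mixedMod p α₁ α₂ δ₁ δ₂ f ^ 2 ≤ ENNReal.ofReal C * modSum α₁ α₂ δ₁ δ₂ (toPlane f) := by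
  obtain ⟨C, hC, H⟩ := exists_eLpNorm_sq_le_coefSq p hp.le
  refine ⟨C * (2 ^ (2 * α₁) * 2 ^ (2 * α₂)), by positivity, fun f hf hsupp δ₁ δ₂ => ?_⟩
  rw [← ENNReal.rpow_two, ← ENNReal.le_rpow_inv_iff two_pos]
  refine iSup₂_le fun h₁ hh₁ => iSup₂_le fun h₂ hh₂ => ?_
  rw [ENNReal.le_rpow_inv_iff two_pos, ENNReal.rpow_two]
  have hD := (hf.diffY hα₂ h₂).diffX hα₁ h₁
  rw [Lp2Norm_eq_eLpNorm (by linarith) hD.meas]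
  refine (H _ hD.integrable_toPlane fun k hk => ?_).trans ?_
  · rw [hf.coef2_diffX_diffY hα₁ hα₂, hsupp k hk, mul_zero]
  · rw [hf.coefSq_diffX_diffY hα₁ hα₂, ENNReal.ofReal_mul hC.le, mul_assoc]
    refine mul_le_mul_right ?_ _
    rw [modSum, ← ENNReal.tsum_mul_left]
    refine ENNReal.tsum_le_tsum fun k => ?_
    rw [ENNReal.ofReal_mul (by positivity)]
    calc _ ≤ ENNReal.ofReal (2 ^ (2 * α₁)) * ENNReal.ofReal (freqMin k.1 δ₁ ^ (2 * α₁)) *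
          (ENNReal.ofReal (2 ^ (2 * α₂)) * ENNReal.ofReal (freqMin k.2 δ₂ ^ (2 * α₂))) *
          ‖coef2 (toPlane f) k‖ₑ ^ 2 :=
          mul_le_mul_left (mul_le_mul' (enorm_diffSymbol_sq_le hα₁ _ hh₁)
            (enorm_diffSymbol_sq_le hα₂ _ hh₂)) _
      _ = _ := by ring

lemma lintegral_lintegral_Ioc_le {δ₁ δ₂ : ℝ} {u : ℝ → ℝ → ℝ≥0∞} {c : ℝ≥0∞}
    (h : ∀ x ∈ Set.Ioc 0 δ₁, ∀ y ∈ Set.Ioc 0 δ₂, u x y ≤ c) :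
    ∫⁻ x in Set.Ioc 0 δ₁, ∫⁻ y in Set.Ioc 0 δ₂, u x y ≤
      c * ENNReal.ofReal δ₂ * ENNReal.ofReal δ₁ := by
  calc _ ≤ ∫⁻ _ in Set.Ioc 0 δ₁, ∫⁻ _ in Set.Ioc 0 δ₂, c :=
        setLIntegral_mono' measurableSet_Ioc fun x hx =>
          setLIntegral_mono' measurableSet_Ioc fun y hy => h x hx y hy
    _ = _ := by simp

lemma le_of_scaled_le {c₁ c₂ C δ₁ δ₂ : ℝ} (hc₁ : 0 < c₁) (hc₂ : 0 < c₂) (hC : 0 < C)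
    (hδ₁ : 0 < δ₁) (hδ₂ : 0 < δ₂) {S M : ℝ≥0∞}
    (h : ENNReal.ofReal (c₁ * δ₁) * ENNReal.ofReal (c₂ * δ₂) * S ≤
      (ENNReal.ofReal C * M) ^ 2 * ENNReal.ofReal δ₂ * ENNReal.ofReal δ₁) :
    S ≤ ENNReal.ofReal ((c₁ * c₂)⁻¹ * C ^ 2) * M ^ 2 := by
  calc S = ENNReal.ofReal ((c₁ * δ₁ * (c₂ * δ₂))⁻¹) * (ENNReal.ofReal (c₁ * δ₁) *
          ENNReal.ofReal (c₂ * δ₂) * S) := by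
        rw [← ENNReal.ofReal_mul (by positivity), ← mul_assoc,
          ← ENNReal.ofReal_mul (by positivity), inv_mul_cancel₀ (by positivity),
          ENNReal.ofReal_one, one_mul]
    _ ≤ ENNReal.ofReal ((c₁ * δ₁ * (c₂ * δ₂))⁻¹) *
          ((ENNReal.ofReal C * M) ^ 2 * ENNReal.ofReal δ₂ * ENNReal.ofReal δ₁) :=
        mul_le_mul_right h _
    _ = ENNReal.ofReal ((c₁ * δ₁ * (c₂ * δ₂))⁻¹) * ENNReal.ofReal (C ^ 2) *
          ENNReal.ofReal δ₂ * ENNReal.ofReal δ₁ * M ^ 2 := by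
        rw [mul_pow, ENNReal.ofReal_pow hC.le]; ring
    _ = ENNReal.ofReal ((c₁ * c₂)⁻¹ * C ^ 2) * M ^ 2 := by
        rw [← ENNReal.ofReal_mul (by positivity), ← ENNReal.ofReal_mul (by positivity),
          ← ENNReal.ofReal_mul (by positivity)]
        congr 2
        field_simp

lemma exists_modSum_le {p α₁ α₂ : ℝ} (hp : 1 < p) (hα₁ : 0 < α₁) (hα₂ : 0 < α₂) :
    ∃ C : ℝ, 0 < C ∧ ∀ f : ℝ → ℝ → ℝ, PeriodicIntegrable f →
      (∀ k ∉ dyadicFreq, coef2 (toPlane f) k = 0) → ∀ δ₁ δ₂ : ℝ, 0 < δ₁ → 0 < δ₂ →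
        modSum α₁ α₂ δ₁ δ₂ (toPlane f) ≤ ENNReal.ofReal C * mixedMod p α₁ α₂ δ₁ δ₂ f ^ 2 := by
  obtain ⟨C, hC, H⟩ := exists_coefSq_le p hp
  obtain ⟨c₁, hc₁, H₁⟩ := exists_le_lintegral_diffSymbol hα₁
  obtain ⟨c₂, hc₂, H₂⟩ := exists_le_lintegral_diffSymbol hα₂
  refine ⟨(c₁ * c₂)⁻¹ * C ^ 2, by positivity, fun f hf hsupp δ₁ δ₂ hδ₁ hδ₂ => ?_⟩
  have hbound : ∀ h₁ ∈ Set.Ioc 0 δ₁, ∀ h₂ ∈ Set.Ioc 0 δ₂,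
      ∑' k : ℤ × ℤ, ‖diffSymbol α₁ (k.1 * h₁)‖ₑ ^ 2 * ‖diffSymbol α₂ (k.2 * h₂)‖ₑ ^ 2 *
        ‖coef2 (toPlane f) k‖ₑ ^ 2 ≤
      (ENNReal.ofReal C * mixedMod p α₁ α₂ δ₁ δ₂ f) ^ 2 := fun h₁ hh₁ h₂ hh₂ => by
    have hD := (hf.diffY hα₂ h₂).diffX hα₁ h₁
    rw [← hf.coefSq_diffX_diffY hα₁ hα₂]
    refine (H _ hD.integrable_toPlane fun k hk => ?_).trans ?_
    · rw [hf.coef2_diffX_diffY hα₁ hα₂, hsupp k hk, mul_zero]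
    · rw [← Lp2Norm_eq_eLpNorm (by linarith) hD.meas]
      refine pow_le_pow_left' (mul_le_mul_right ?_ _) 2
      exact le_iSup₂_of_le h₁ (abs_le.2 ⟨by linarith [hh₁.1], hh₁.2⟩) <|
        le_iSup₂_of_le h₂ (abs_le.2 ⟨by linarith [hh₂.1], hh₂.2⟩) le_rfl
  have hupper := lintegral_lintegral_Ioc_le hbound
  rw [lintegral_lintegral_tsum_mul _ _
    (fun k : ℤ × ℤ => measurable_enorm_diffSymbol_sq hα₁ k.1)
    (fun k : ℤ × ℤ => measurable_enorm_diffSymbol_sq hα₂ k.2)] at hupper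
  refine le_of_scaled_le hc₁ hc₂ hC hδ₁ hδ₂ (le_trans ?_ hupper)
  rw [modSum, ← ENNReal.tsum_mul_left]
  refine ENNReal.tsum_le_tsum fun k => ?_
  calc _ = ENNReal.ofReal (c₁ * δ₁) * ENNReal.ofReal (freqMin k.1 δ₁ ^ (2 * α₁)) *
        (ENNReal.ofReal (c₂ * δ₂) * ENNReal.ofReal (freqMin k.2 δ₂ ^ (2 * α₂))) *
        ‖coef2 (toPlane f) k‖ₑ ^ 2 := by ring
    _ ≤ _ := mul_le_mul_left (mul_le_mul' (H₁ _ _ hδ₁) (H₂ _ _ hδ₂)) _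

/-- The weighted square sum of Fourier coefficients which is equivalent to the square of the mixed
modulus of smoothness of the mixed Weyl derivative. -/
def derivModSum (β₁ β₂ r₁ r₂ δ₁ δ₂ : ℝ) (F : ℝ × ℝ → ℂ) : ℝ≥0∞ :=
  ∑' k : ℤ × ℤ, ENNReal.ofReal (|(k.1 : ℝ)| ^ (2 * r₁) * freqMin k.1 δ₁ ^ (2 * β₁)) *
    ENNReal.ofReal (|(k.2 : ℝ)| ^ (2 * r₂) * freqMin k.2 δ₂ ^ (2 * β₂)) * ‖coef2 F k‖ₑ ^ 2

/-- The weighted integral of `modSum` over steps. -/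
def modSumIntegral (β₁ β₂ r₁ r₂ δ₁ δ₂ : ℝ) (F : ℝ × ℝ → ℂ) : ℝ≥0∞ :=
  ∫⁻ t₁ in Set.Ioo 0 δ₁, ∫⁻ t₂ in Set.Ioo 0 δ₂,
    ENNReal.ofReal (t₁ ^ (-r₁*2-1) * t₂ ^ (-r₂*2-1)) * modSum (r₁ + β₁) (r₂ + β₂) t₁ t₂ F

lemma measurable_rpow_mul_freqMin (m : ℤ) (r β : ℝ) : Measurable fun t : ℝ =>
    ENNReal.ofReal (t ^ (-r*2-1) * freqMin m t ^ (2 * (r + β))) := by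
  unfold freqMin; fun_prop

lemma modSumIntegral_eq (β₁ β₂ r₁ r₂ δ₁ δ₂ : ℝ) (F : ℝ × ℝ → ℂ) :
    modSumIntegral β₁ β₂ r₁ r₂ δ₁ δ₂ F = ∑' k : ℤ × ℤ,
      (∫⁻ t in Set.Ioo 0 δ₁, ENNReal.ofReal (t ^ (-r₁*2-1) * freqMin k.1 t ^ (2 * (r₁ + β₁)))) *
      (∫⁻ t in Set.Ioo 0 δ₂, ENNReal.ofReal (t ^ (-r₂*2-1) * freqMin k.2 t ^ (2 * (r₂ + β₂)))) *
      ‖coef2 F k‖ₑ ^ 2 := by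
  rw [← lintegral_lintegral_tsum_mul _ _ (fun k : ℤ × ℤ => measurable_rpow_mul_freqMin k.1 r₁ β₁)
    (fun k => measurable_rpow_mul_freqMin k.2 r₂ β₂), modSumIntegral]
  refine setLIntegral_congr_fun measurableSet_Ioo fun t₁ ht₁ =>
    setLIntegral_congr_fun measurableSet_Ioo fun t₂ ht₂ => ?_
  rw [modSum, ← ENNReal.tsum_mul_left]
  refine tsum_congr fun k => ?_
  have h₁ := Real.rpow_nonneg ht₁.1.le (-r₁*2-1)
  have h₂ := Real.rpow_nonneg ht₂.1.le (-r₂*2-1)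
  rw [ENNReal.ofReal_mul h₁, ENNReal.ofReal_mul h₁, ENNReal.ofReal_mul h₂]
  ring

lemma ne_zero_of_mem_dyadicFreq {k : ℤ × ℤ} (hk : k ∈ dyadicFreq) : k.1 ≠ 0 ∧ k.2 ≠ 0 := by
  obtain ⟨⟨μ, hμ⟩, ν, hν⟩ := hk
  constructor
  · intro h; rw [h] at hμ; exact absurd hμ.symm (by simp)
  · intro h; rw [h] at hν; exact absurd hν.symm (by simp)

lemma modSumIntegral_bounds {β₁ β₂ r₁ r₂ δ₁ δ₂ : ℝ} (hβ₁ : 0 < β₁) (hβ₂ : 0 < β₂) (hr₁ : 0 < r₁)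
    (hr₂ : 0 < r₂) (hδ₁ : 0 < δ₁) (hδ₂ : 0 < δ₂) {F : ℝ × ℝ → ℂ}
    (hF : ∀ k ∉ dyadicFreq, coef2 F k = 0) :
    ENNReal.ofReal (1 / (2 * β₁) * (1 / (2 * β₂))) * derivModSum β₁ β₂ r₁ r₂ δ₁ δ₂ F ≤
      modSumIntegral β₁ β₂ r₁ r₂ δ₁ δ₂ F ∧
    modSumIntegral β₁ β₂ r₁ r₂ δ₁ δ₂ F ≤
      ENNReal.ofReal ((1 / (2 * β₁) + 1 / (2 * r₁)) * (1 / (2 * β₂) + 1 / (2 * r₂))) *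
        derivModSum β₁ β₂ r₁ r₂ δ₁ δ₂ F := by
  rw [modSumIntegral_eq, derivModSum, ← ENNReal.tsum_mul_left, ← ENNReal.tsum_mul_left,
    ENNReal.ofReal_mul (by positivity), ENNReal.ofReal_mul (by positivity)]
  have key : ∀ k ∈ dyadicFreq, 0 < |(k.1 : ℝ)| ∧ 0 < |(k.2 : ℝ)| := fun k hk => by
    have := ne_zero_of_mem_dyadicFreq hk
    simpa using this
  constructor
  · refine ENNReal.tsum_le_tsum fun k => ?_
    by_cases hk : k ∈ dyadicFreq
    · have b₁ := (lintegral_rpow_mul_min_bounds (key k hk).1 hδ₁ hr₁ hβ₁).1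
      have b₂ := (lintegral_rpow_mul_min_bounds (key k hk).2 hδ₂ hr₂ hβ₂).1
      calc _ = ENNReal.ofReal (1 / (2 * β₁)) *
            ENNReal.ofReal (|(k.1 : ℝ)| ^ (2 * r₁) * freqMin k.1 δ₁ ^ (2 * β₁)) *
            (ENNReal.ofReal (1 / (2 * β₂)) *
              ENNReal.ofReal (|(k.2 : ℝ)| ^ (2 * r₂) * freqMin k.2 δ₂ ^ (2 * β₂))) *
            ‖coef2 F k‖ₑ ^ 2 := by ring
        _ ≤ _ := mul_le_mul_left (mul_le_mul' b₁ b₂) _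
    · simp [hF k hk]
  · refine ENNReal.tsum_le_tsum fun k => ?_
    by_cases hk : k ∈ dyadicFreq
    · have b₁ := (lintegral_rpow_mul_min_bounds (key k hk).1 hδ₁ hr₁ hβ₁).2
      have b₂ := (lintegral_rpow_mul_min_bounds (key k hk).2 hδ₂ hr₂ hβ₂).2
      calc _ ≤ ENNReal.ofReal (1 / (2 * β₁) + 1 / (2 * r₁)) *
            ENNReal.ofReal (|(k.1 : ℝ)| ^ (2 * r₁) * freqMin k.1 δ₁ ^ (2 * β₁)) *
            (ENNReal.ofReal (1 / (2 * β₂) + 1 / (2 * r₂)) *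
              ENNReal.ofReal (|(k.2 : ℝ)| ^ (2 * r₂) * freqMin k.2 δ₂ ^ (2 * β₂))) *
            ‖coef2 F k‖ₑ ^ 2 := mul_le_mul_left (mul_le_mul' b₁ b₂) _
        _ = _ := by ring
    · simp [hF k hk]

lemma derivMajorant_two_sq (p β₁ β₂ r₁ r₂ δ₁ δ₂ : ℝ) (f : ℝ → ℝ → ℝ) :
    derivMajorant p β₁ β₂ r₁ r₂ 2 δ₁ δ₂ f ^ 2 =
      ∫⁻ t₁ in Set.Ioo 0 δ₁, ∫⁻ t₂ in Set.Ioo 0 δ₂,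
        ENNReal.ofReal (t₁ ^ (-r₁*2-1) * t₂ ^ (-r₂*2-1)) *
          mixedMod p (r₁ + β₁) (r₂ + β₂) t₁ t₂ f ^ 2 := by
  rw [derivMajorant, ← ENNReal.rpow_two, ← ENNReal.rpow_mul, one_div_mul_cancel two_ne_zero,
    ENNReal.rpow_one]
  simp_rw [ENNReal.rpow_two]

lemma lintegral_lintegral_const_mul {c : ℝ≥0∞} (hc : c ≠ ⊤) (μ ν : Measure ℝ)
    (u v : ℝ → ℝ → ℝ≥0∞) : ∫⁻ x, ∫⁻ y, u x y * (c * v x y) ∂ν ∂μ =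
      c * ∫⁻ x, ∫⁻ y, u x y * v x y ∂ν ∂μ := by
  rw [← lintegral_const_mul' _ _ hc]
  refine lintegral_congr fun x => ?_
  rw [← lintegral_const_mul' _ _ hc]
  exact lintegral_congr fun y => by ring

/-- The square of the majorant is equivalent to the weighted square sum of coefficients. -/
lemma exists_derivMajorant_bounds {p β₁ β₂ r₁ r₂ : ℝ} (hp : 1 < p) (hβ₁ : 0 < β₁) (hβ₂ : 0 < β₂)
    (hr₁ : 0 < r₁) (hr₂ : 0 < r₂) : ∃ C : ℝ, 0 < C ∧ ∀ f : ℝ → ℝ → ℝ, PeriodicIntegrable f →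
      (∀ k ∉ dyadicFreq, coef2 (toPlane f) k = 0) → ∀ δ₁ δ₂ : ℝ, 0 < δ₁ → 0 < δ₂ →
        derivMajorant p β₁ β₂ r₁ r₂ 2 δ₁ δ₂ f ^ 2 ≤
          ENNReal.ofReal C * derivModSum β₁ β₂ r₁ r₂ δ₁ δ₂ (toPlane f) ∧
        derivModSum β₁ β₂ r₁ r₂ δ₁ δ₂ (toPlane f) ≤
          ENNReal.ofReal C * derivMajorant p β₁ β₂ r₁ r₂ 2 δ₁ δ₂ f ^ 2 := by
  obtain ⟨C, hC, H⟩ := exists_mixedMod_sq_le hp (add_pos hr₁ hβ₁) (add_pos hr₂ hβ₂)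
  obtain ⟨C', hC', H'⟩ := exists_modSum_le hp (add_pos hr₁ hβ₁) (add_pos hr₂ hβ₂)
  set A := (1 / (2 * β₁) + 1 / (2 * r₁)) * (1 / (2 * β₂) + 1 / (2 * r₂)) with hA
  set B := 1 / (2 * β₁) * (1 / (2 * β₂)) with hB
  have hA0 : 0 < A := by positivity
  have hB0 : 0 < B := by positivity
  refine ⟨max (C * A) (B⁻¹ * C'), by positivity, fun f hf hsupp δ₁ δ₂ hδ₁ hδ₂ => ?_⟩
  obtain ⟨b₁, b₂⟩ := modSumIntegral_bounds hβ₁ hβ₂ hr₁ hr₂ hδ₁ hδ₂ hsupp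
  rw [derivMajorant_two_sq]
  constructor
  · calc _ ≤ ∫⁻ t₁ in Set.Ioo 0 δ₁, ∫⁻ t₂ in Set.Ioo 0 δ₂,
          ENNReal.ofReal (t₁ ^ (-r₁*2-1) * t₂ ^ (-r₂*2-1)) *
            (ENNReal.ofReal C * modSum (r₁ + β₁) (r₂ + β₂) t₁ t₂ (toPlane f)) := by
          gcongr
          exact H f hf hsupp _ _
      _ = ENNReal.ofReal C * modSumIntegral β₁ β₂ r₁ r₂ δ₁ δ₂ (toPlane f) :=
          lintegral_lintegral_const_mul ENNReal.ofReal_ne_top _ _ _ _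
      _ ≤ ENNReal.ofReal C * (ENNReal.ofReal A * derivModSum β₁ β₂ r₁ r₂ δ₁ δ₂ (toPlane f)) := by
          gcongr
      _ ≤ _ := by
          rw [← mul_assoc, ← ENNReal.ofReal_mul hC.le]
          gcongr
          exact le_max_left _ _
  · calc derivModSum β₁ β₂ r₁ r₂ δ₁ δ₂ (toPlane f)
        = ENNReal.ofReal B⁻¹ *
          (ENNReal.ofReal B * derivModSum β₁ β₂ r₁ r₂ δ₁ δ₂ (toPlane f)) := by
          rw [← mul_assoc, ← ENNReal.ofReal_mul (by positivity), inv_mul_cancel₀ hB0.ne',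
            ENNReal.ofReal_one, one_mul]
      _ ≤ ENNReal.ofReal B⁻¹ * modSumIntegral β₁ β₂ r₁ r₂ δ₁ δ₂ (toPlane f) := by gcongr
      _ ≤ ENNReal.ofReal B⁻¹ * ∫⁻ t₁ in Set.Ioo 0 δ₁, ∫⁻ t₂ in Set.Ioo 0 δ₂,
          ENNReal.ofReal (t₁ ^ (-r₁*2-1) * t₂ ^ (-r₂*2-1)) *
            (ENNReal.ofReal C' * mixedMod p (r₁ + β₁) (r₂ + β₂) t₁ t₂ f ^ 2) := by
          refine mul_le_mul_right (setLIntegral_mono' measurableSet_Ioo fun t₁ ht₁ =>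
            setLIntegral_mono' measurableSet_Ioo fun t₂ ht₂ => ?_) _
          gcongr
          exact H' f hf hsupp _ _ ht₁.1 ht₂.1
      _ ≤ _ := by
          rw [lintegral_lintegral_const_mul ENNReal.ofReal_ne_top, ← mul_assoc,
            ← ENNReal.ofReal_mul (by positivity)]
          gcongr
          exact le_max_right _ _

/-- The Fourier multiplier of the Weyl derivative of order `r` in one variable. -/
def weylSymbol (r : ℝ) (m : ℤ) : ℂ := (Complex.I * (m : ℂ)) ^ (r : ℂ)

lemma norm_weylSymbol (r : ℝ) (m : ℤ) : ‖weylSymbol r m‖ = |(m : ℝ)| ^ r := by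
  rw [weylSymbol, Complex.norm_cpow_real, norm_mul, Complex.norm_I, one_mul, Complex.norm_intCast]

lemma enorm_weylSymbol_sq (r : ℝ) (m : ℤ) :
    ‖weylSymbol r m‖ₑ ^ 2 = ENNReal.ofReal (|(m : ℝ)| ^ (2 * r)) := by
  rw [← ofReal_norm, norm_weylSymbol, ← ENNReal.ofReal_pow (by positivity), ← Real.rpow_natCast,
    ← Real.rpow_mul (abs_nonneg _), mul_comm r]
  rfl

lemma weylSymbol_zero {r : ℝ} (hr : 0 < r) : weylSymbol r 0 = 0 := by
  rw [weylSymbol, Int.cast_zero, mul_zero, Complex.zero_cpow (by exact_mod_cast hr.ne')]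

lemma weylSymbol_neg (r : ℝ) (m : ℤ) :
    weylSymbol r (-m) = (starRingEnd ℂ) (weylSymbol r m) := by
  have harg : (Complex.I * (m : ℂ)).arg ≠ π := fun h => by
    have := (Complex.arg_eq_pi_iff.1 h).1
    simp at this
  have h := Complex.conj_cpow (Complex.I * (m : ℂ)) (r : ℂ) harg
  rw [Complex.conj_ofReal] at h
  rw [weylSymbol, weylSymbol, ← h]
  congr 1
  simp

lemma HasWeylDeriv.coef2_eq {p r₁ r₂ : ℝ} (hp : 1 ≤ p) {f g : ℝ → ℝ → ℝ}
    (hf : PeriodicIntegrable f) (h : HasWeylDeriv p r₁ r₂ f g) (k : ℤ × ℤ) :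
    coef2 (toPlane g) k = weylSymbol r₁ k.1 * weylSymbol r₂ k.2 * coef2 (toPlane f) k := by
  have h1 := h.2 k.1 k.2
  rw [(h.1.periodicIntegrable hp).fourierCoefZ_eq, hf.fourierCoefZ_eq, mul_left_comm] at h1
  exact mul_left_cancel₀ (Complex.ofReal_ne_zero.2 (by positivity)) h1

lemma modSum_eq_derivModSum {β₁ β₂ r₁ r₂ δ₁ δ₂ : ℝ} {F G : ℝ × ℝ → ℂ}
    (h : ∀ k, coef2 G k = weylSymbol r₁ k.1 * weylSymbol r₂ k.2 * coef2 F k) :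
    modSum β₁ β₂ δ₁ δ₂ G = derivModSum β₁ β₂ r₁ r₂ δ₁ δ₂ F := by
  refine tsum_congr fun k => ?_
  rw [h, enorm_mul, enorm_mul, mul_pow, mul_pow, enorm_weylSymbol_sq, enorm_weylSymbol_sq,
    ENNReal.ofReal_mul (by positivity), ENNReal.ofReal_mul (by positivity)]
  ring

lemma le_ofReal_sqrt_mul_of_sq_le {a b : ℝ≥0∞} {C : ℝ} (h : a ^ 2 ≤ ENNReal.ofReal C * b ^ 2) :
    a ≤ ENNReal.ofReal √C * b := by
  rw [← ENNReal.pow_le_pow_left_iff two_ne_zero, mul_pow, ← ENNReal.ofReal_pow (sqrt_nonneg _)]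
  refine h.trans (mul_le_mul_left (ENNReal.ofReal_le_ofReal ?_) _)
  rcases le_total 0 C with hC | hC
  · rw [Real.sq_sqrt hC]
  · exact hC.trans (sq_nonneg _)

/-- The two-sided estimate for the modulus of smoothness of the Weyl derivative. -/
lemma exists_mixedMod_weylDeriv_bounds {p β₁ β₂ r₁ r₂ : ℝ} (hp : 1 < p) (hβ₁ : 0 < β₁)
    (hβ₂ : 0 < β₂) (hr₁ : 0 < r₁) (hr₂ : 0 < r₂) : ∃ C : ℝ, 0 < C ∧ ∀ f g : ℝ → ℝ → ℝ,
      PeriodicIntegrable f → (∀ k ∉ dyadicFreq, coef2 (toPlane f) k = 0) →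
      HasWeylDeriv p r₁ r₂ f g → ∀ δ₁ δ₂ : ℝ, 0 < δ₁ → 0 < δ₂ →
        mixedMod p β₁ β₂ δ₁ δ₂ g ≤
            ENNReal.ofReal C * derivMajorant p β₁ β₂ r₁ r₂ 2 δ₁ δ₂ f ∧
        derivMajorant p β₁ β₂ r₁ r₂ 2 δ₁ δ₂ f ≤
            ENNReal.ofReal C * mixedMod p β₁ β₂ δ₁ δ₂ g := by
  obtain ⟨C, hC, H⟩ := exists_derivMajorant_bounds hp hβ₁ hβ₂ hr₁ hr₂
  obtain ⟨A, hA, HA⟩ := exists_mixedMod_sq_le hp hβ₁ hβ₂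
  obtain ⟨B, hB, HB⟩ := exists_modSum_le hp hβ₁ hβ₂
  refine ⟨√(max (A * C) (C * B)), by positivity,
    fun f g hf hsupp hfg δ₁ δ₂ hδ₁ hδ₂ => ?_⟩
  have hg := hfg.1.periodicIntegrable hp.le
  have hcoef := hfg.coef2_eq hp.le hf
  have hsuppg : ∀ k ∉ dyadicFreq, coef2 (toPlane g) k = 0 := fun k hk => by
    rw [hcoef, hsupp k hk, mul_zero]
  obtain ⟨b₁, b₂⟩ := H f hf hsupp δ₁ δ₂ hδ₁ hδ₂
  have a₁ := HA g hg hsuppg δ₁ δ₂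
  have a₂ := HB g hg hsuppg δ₁ δ₂ hδ₁ hδ₂
  rw [modSum_eq_derivModSum hcoef] at a₁ a₂
  constructor <;> apply le_ofReal_sqrt_mul_of_sq_le
  · refine (a₁.trans (mul_le_mul_right b₂ _)).trans ?_
    rw [← mul_assoc, ← ENNReal.ofReal_mul hA.le]
    exact mul_le_mul_left (ENNReal.ofReal_le_ofReal (le_max_left _ _)) _
  · refine (b₁.trans (mul_le_mul_right a₂ _)).trans ?_
    rw [← mul_assoc, ← ENNReal.ofReal_mul hC.le]
    exact mul_le_mul_left (ENNReal.ofReal_le_ofReal (le_max_right _ _)) _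

/-- The representative of `x` modulo `2π` in `(0,2π]`. -/
def wrapIoc (x : ℝ) : ℝ := 2*π - 2*π * Int.fract (-x / (2*π))

lemma measurable_wrapIoc : Measurable wrapIoc :=
  ((measurable_fract.comp (measurable_neg.div_const _)).const_mul _).const_sub _

lemma wrapIoc_periodic : Function.Periodic wrapIoc (2*π) := fun x => by
  have h : -(x + 2*π) / (2*π) = -x / (2*π) - 1 := by field_simp; ring
  rw [wrapIoc, wrapIoc, h, Int.fract_sub_one]

lemma wrapIoc_eq_self {x : ℝ} (hx : x ∈ Set.Ioc 0 (2*π)) : wrapIoc x = x := by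
  have hpi : 0 < 2*π := by positivity
  have h : Int.fract (-x / (2*π)) = -x / (2*π) + 1 := by
    refine Int.fract_eq_iff.2 ⟨?_, ?_, -1, by push_cast; ring⟩
    · have : x / (2*π) ≤ 1 := (div_le_one hpi).2 hx.2
      rw [neg_div]; linarith
    · have : 0 < x / (2*π) := div_pos hx.1 hpi
      rw [neg_div]; linarith
  rw [wrapIoc, h]; field_simp; ring

lemma ae_of_ae_restrict_Ioc_of_periodic {P : ℝ → Prop} (hP : Function.Periodic P (2*π))
    (h : ∀ᵐ x ∂volume.restrict (Set.Ioc 0 (2*π)), P x) : ∀ᵐ x, P x := by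
  have hpi : 0 < 2*π := by positivity
  have hfd := isAddFundamentalDomain_Ioc hpi 0
  rw [zero_add] at hfd
  rw [ae_iff] at h ⊢
  refine hfd.measure_zero_of_invariant _ (fun g => ?_) ?_
  · obtain ⟨_, n, rfl⟩ := g
    ext x
    rw [Set.mem_vadd_set_iff_neg_vadd_mem]
    have : P (-(n • (2*π)) + x) = P x := by
      rw [neg_add_eq_sub]; exact hP.sub_zsmul_eq n
    exact not_congr (iff_of_eq this)
  · rwa [Measure.restrict_apply₀' measurableSet_Ioc.nullMeasurableSet] at h

lemma coef2_conj (F : ℝ × ℝ → ℂ) (k : ℤ × ℤ) :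
    coef2 (fun z => (starRingEnd ℂ) (F z)) k = (starRingEnd ℂ) (coef2 F (-k)) := by
  rw [coef2, coef2, ← integral_conj]
  refine integral_congr_ae (Filter.Eventually.of_forall fun z => ?_)
  simp only [map_mul, conj_char2, neg_neg]

lemma coef2_congr_ae {F G : ℝ × ℝ → ℂ} (h : F =ᵐ[periodSq] G) (k : ℤ × ℤ) :
    coef2 F k = coef2 G k :=
  integral_congr_ae (h.mono fun z hz => by simp only [hz])

/-- A function whose Fourier coefficients are conjugate symmetric agrees almost everywhere on the
period square with a real measurable periodic function. -/
lemma exists_periodicIntegrable_ae_eq {F : ℝ × ℝ → ℂ} (hF : Integrable F periodSq)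
    (hconj : ∀ k, coef2 F (-k) = (starRingEnd ℂ) (coef2 F k)) :
    ∃ g : ℝ → ℝ → ℝ, PeriodicIntegrable g ∧ toPlane g =ᵐ[periodSq] F := by
  have hreal : (fun z => (starRingEnd ℂ) (F z)) =ᵐ[periodSq] F := by
    refine ae_eq_of_coef2_eq ?_ hF fun k => ?_
    · exact (LinearIsometryEquiv.integrable_comp_iff Complex.conjLIE).2 hF
    · rw [coef2_conj, hconj, Complex.conj_conj]
  set F₁ := hF.1.mk F with hF₁
  have hF₁m : Measurable F₁ := hF.1.stronglyMeasurable_mk.measurable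
  set g : ℝ → ℝ → ℝ := fun x y => (F₁ (wrapIoc x, wrapIoc y)).re with hg
  have hgm : Measurable (Function.uncurry g) :=
    Complex.measurable_re.comp (hF₁m.comp
      ((measurable_wrapIoc.comp measurable_fst).prodMk (measurable_wrapIoc.comp measurable_snd)))
  have hae : toPlane g =ᵐ[periodSq] F := by
    filter_upwards [hreal, hF.1.ae_eq_mk, ae_periodSq_mem] with z h1 h2 h3
    rw [toPlane, hg]
    simp only
    rw [wrapIoc_eq_self h3.1, wrapIoc_eq_self h3.2, hF₁, Prod.mk.eta, ← h2]
    exact Complex.conj_eq_iff_re.1 h1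
  refine ⟨g, ⟨hgm, fun y x => ?_, fun x y => ?_, ?_⟩, hae⟩
  · simp only [hg, wrapIoc_periodic x]
  · simp only [hg, wrapIoc_periodic y]
  · exact (hF.congr hae.symm).re

lemma PeriodicIntegrable.ae_integral_eq_zero {f : ℝ → ℝ → ℝ} (hf : PeriodicIntegrable f)
    (h0 : ∀ n, coef2 (toPlane f) (0, n) = 0) :
    ∀ᵐ y, ∫ x in (0:ℝ)..(2*π), f x y = 0 := by
  have hpi : (0:ℝ) ≤ 2*π := by positivity
  set μ : Measure ℝ := volume.restrict (Set.Ioc 0 (2*π)) with hμ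
  set φ : ℝ → ℂ := fun y => ∫ x, toPlane f (x, y) ∂μ with hφ
  have hfi : Integrable (toPlane f) (μ.prod μ) := hf.integrable_toPlane
  have hφi : Integrable φ μ := hfi.integral_prod_right
  have hΦ : (fun z : ℝ × ℝ => φ z.2) =ᵐ[periodSq] 0 := by
    refine ae_eq_zero_of_coef2_eq_zero (hφi.comp_snd μ) fun k => ?_
    have hsplit : ∀ z : ℝ × ℝ, φ z.2 * char2 (-k) z =
        Complex.exp (Complex.I * (((-k.1 : ℤ) : ℂ) * z.1)) *
          (φ z.2 * Complex.exp (Complex.I * (((-k.2 : ℤ) : ℂ) * z.2))) := fun z => by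
      rw [char2, mul_add, Complex.exp_add]
      simp only [Prod.fst_neg, Prod.snd_neg]
      ring
    rw [coef2]
    simp_rw [hsplit]
    rw [periodSq, integral_prod_mul (fun x : ℝ => Complex.exp (Complex.I * (((-k.1 : ℤ) : ℂ) * x)))
      (fun y : ℝ => φ y * Complex.exp (Complex.I * (((-k.2 : ℤ) : ℂ) * y))), integral_exp_int]
    rcases eq_or_ne k.1 0 with hk | hk
    · rw [mul_eq_zero]
      right
      have h1 := h0 k.2
      rw [coef2, periodSq,
        integral_prod_symm _ (integrable_mul_char2 hf.integrable_toPlane _)] at h1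
      rw [← h1]
      refine integral_congr_ae (Filter.Eventually.of_forall fun y => ?_)
      simp only [hφ]
      rw [← integral_mul_const]
      refine integral_congr_ae (Filter.Eventually.of_forall fun x => ?_)
      simp [char2]
    · rw [if_neg (by simpa using hk), zero_mul]
  have hμ0 : NeZero μ := ⟨by
    rw [hμ, Ne, Measure.restrict_eq_zero, Real.volume_Ioc]
    simp [Real.pi_pos]⟩
  have hφ0 : ∀ᵐ y ∂μ, φ y = 0 := (Measure.ae_ae_of_ae_prod hΦ).exists.choose_spec
  refine ae_of_ae_restrict_Ioc_of_periodic (fun y => ?_) ?_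
  · simp only [hf.periodic_y _ y]
  · filter_upwards [hφ0] with y hy
    rw [intervalIntegral.integral_of_le hpi]
    have : φ y = ((∫ x in Set.Ioc 0 (2*π), f x y : ℝ) : ℂ) := integral_ofReal
    rw [hy] at this
    exact_mod_cast this.symm

lemma PeriodicIntegrable.memLp0 {p : ℝ} (hp : 0 < p) {g : ℝ → ℝ → ℝ} (hg : PeriodicIntegrable g)
    (hmem : MemLp (toPlane g) (ENNReal.ofReal p) periodSq)
    (h₁ : ∀ n, coef2 (toPlane g) (0, n) = 0) (h₂ : ∀ n, coef2 (toPlane g) (n, 0) = 0) :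
    MemLp0 p g where
  meas := hg.meas
  periodic_x := hg.periodic_x
  periodic_y := hg.periodic_y
  norm_ne_top := by
    rw [Lp2Norm_eq_eLpNorm hp hg.meas]
    exact hmem.2.ne
  mean_x := hg.ae_integral_eq_zero h₁
  mean_y := hg.flip.ae_integral_eq_zero fun n => by rw [coef2_flip]; exact h₂ n

lemma summable_of_derivModSum_ne_top {β₁ β₂ r₁ r₂ δ₁ δ₂ : ℝ} (hβ₁ : 0 < β₁) (hβ₂ : 0 < β₂)
    (hδ₁ : 0 < δ₁) (hδ₂ : 0 < δ₂) {F : ℝ × ℝ → ℂ} (hF : ∀ k ∉ dyadicFreq, coef2 F k = 0)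
    (h : derivModSum β₁ β₂ r₁ r₂ δ₁ δ₂ F ≠ ⊤) :
    Summable fun k => ‖weylSymbol r₁ k.1 * weylSymbol r₂ k.2 * coef2 F k‖ ^ 2 := by
  have hm₁ : 0 < min 1 δ₁ := by positivity
  have hm₂ : 0 < min 1 δ₂ := by positivity
  set c := (min 1 δ₁) ^ (2 * β₁) * (min 1 δ₂) ^ (2 * β₂) with hc
  have hc0 : 0 < c := by positivity
  have hfreq : ∀ (m : ℤ) {δ β : ℝ}, m ≠ 0 → 0 < δ → 0 < β →
      (min 1 δ) ^ (2 * β) ≤ freqMin m δ ^ (2 * β) := fun m δ β hm hδ hβ => by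
    refine Real.rpow_le_rpow (by positivity) (min_le_min_left 1 ?_) (by positivity)
    have : (1:ℝ) ≤ |(m : ℝ)| := by exact_mod_cast Int.one_le_abs hm
    nlinarith
  have hle : ENNReal.ofReal c *
      ∑' k : ℤ × ℤ, ‖weylSymbol r₁ k.1 * weylSymbol r₂ k.2 * coef2 F k‖ₑ ^ 2 ≤
      derivModSum β₁ β₂ r₁ r₂ δ₁ δ₂ F := by
    rw [← ENNReal.tsum_mul_left]
    refine ENNReal.tsum_le_tsum fun k => ?_
    by_cases hk : k ∈ dyadicFreq
    · obtain ⟨k₁, k₂⟩ := ne_zero_of_mem_dyadicFreq hk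
      rw [enorm_mul, enorm_mul, mul_pow, mul_pow, enorm_weylSymbol_sq, enorm_weylSymbol_sq, hc,
        ENNReal.ofReal_mul (by positivity)]
      calc _ = ENNReal.ofReal (|(k.1 : ℝ)| ^ (2 * r₁)) * ENNReal.ofReal (min 1 δ₁ ^ (2 * β₁)) *
            (ENNReal.ofReal (|(k.2 : ℝ)| ^ (2 * r₂)) * ENNReal.ofReal (min 1 δ₂ ^ (2 * β₂))) *
            ‖coef2 F k‖ₑ ^ 2 := by ring
        _ ≤ _ := by
          rw [← ENNReal.ofReal_mul (by positivity), ← ENNReal.ofReal_mul (by positivity)]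
          refine mul_le_mul_left (mul_le_mul' (ENNReal.ofReal_le_ofReal ?_)
            (ENNReal.ofReal_le_ofReal ?_)) _
          · exact mul_le_mul_of_nonneg_left (hfreq _ k₁ hδ₁ hβ₁) (by positivity)
          · exact mul_le_mul_of_nonneg_left (hfreq _ k₂ hδ₂ hβ₂) (by positivity)
    · simp [hF k hk]
  have hne : ∑' k : ℤ × ℤ, ‖weylSymbol r₁ k.1 * weylSymbol r₂ k.2 * coef2 F k‖ₑ ^ 2 ≠ ⊤ :=
    fun htop => h <| top_le_iff.1 <| by
      rwa [htop, ENNReal.mul_top (by simpa using hc0)] at hle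
  refine (ENNReal.summable_toReal hne).congr fun k => ?_
  rw [ENNReal.toReal_pow, toReal_enorm]

/-- The Weyl derivative exists as soon as the weighted coefficient sum is finite. -/
lemma exists_hasWeylDeriv {p β₁ β₂ r₁ r₂ δ₁ δ₂ : ℝ} (hp : 1 ≤ p) (hβ₁ : 0 < β₁) (hβ₂ : 0 < β₂)
    (hr₁ : 0 < r₁) (hr₂ : 0 < r₂) (hδ₁ : 0 < δ₁) (hδ₂ : 0 < δ₂) {f : ℝ → ℝ → ℝ}
    (hf : PeriodicIntegrable f) (hsupp : ∀ k ∉ dyadicFreq, coef2 (toPlane f) k = 0)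
    (h : derivModSum β₁ β₂ r₁ r₂ δ₁ δ₂ (toPlane f) ≠ ⊤) :
    ∃ g : ℝ → ℝ → ℝ, HasWeylDeriv p r₁ r₂ f g := by
  obtain ⟨_, -, H⟩ := exists_memLp_coef2_eq p hp
  set d : ℤ × ℤ → ℂ :=
    fun k => weylSymbol r₁ k.1 * weylSymbol r₂ k.2 * coef2 (toPlane f) k with hd
  obtain ⟨G, hGp, hGc, -⟩ := H (fun k => ((2*π : ℂ)^2)⁻¹ * d k)
    (fun k hk => by simp [hd, hsupp k hk]) <| by
      simp_rw [norm_mul, mul_pow]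
      exact (summable_of_derivModSum_ne_top hβ₁ hβ₂ hδ₁ hδ₂ hsupp h).mul_left _
  have hGd : ∀ k, coef2 G k = d k := fun k => by
    rw [hGc, mul_inv_cancel_left₀ (by simp [Real.pi_ne_zero])]
  have hGi : Integrable G periodSq := hGp.integrable (by
    rw [← ENNReal.ofReal_one]; exact ENNReal.ofReal_le_ofReal hp)
  obtain ⟨g, hg, hgG⟩ := exists_periodicIntegrable_ae_eq hGi fun k => by
    have hfconj : coef2 (toPlane f) (-k) = (starRingEnd ℂ) (coef2 (toPlane f) k) := by
      have := coef2_conj (toPlane f) (-k)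
      have hr : (fun z => (starRingEnd ℂ) (toPlane f z)) = toPlane f :=
        funext fun _ => Complex.conj_ofReal _
      rwa [neg_neg, hr] at this
    rw [hGd, hGd, hd]
    simp only [map_mul, Prod.fst_neg, Prod.snd_neg, weylSymbol_neg, hfconj]
  have hgd : ∀ k, coef2 (toPlane g) k = d k := fun k => by rw [coef2_congr_ae hgG, hGd]
  refine ⟨g, hg.memLp0 (by linarith) ((memLp_congr_ae hgG).2 hGp) (fun n => ?_) (fun n => ?_),
    fun m n => ?_⟩
  · rw [hgd, hd]; simp [weylSymbol_zero hr₁]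
  · rw [hgd, hd]; simp [weylSymbol_zero hr₂]
  · rw [hg.fourierCoefZ_eq, hf.fourierCoefZ_eq, hgd, hd]
    simp only [weylSymbol]
    ring

/-- For `f ∈ Λ_p`, the mixed modulus of smoothness of the mixed Weyl derivative is
equivalent to the integral (with exponent 2) of the higher-order modulus of `f`
(Theorem 8.3). -/
theorem modulus_of_derivative_Lambda (p β₁ β₂ r₁ r₂ : ℝ) (hp : 1 < p)
    (hβ₁ : 0 < β₁) (hβ₂ : 0 < β₂) (hr₁ : 0 < r₁) (hr₂ : 0 < r₂) :
    ∃ C : ℝ, 0 < C ∧ ∀ (f : ℝ → ℝ → ℝ) (lam : ℕ → ℕ → ℝ) (δ₁ δ₂ : ℝ),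
      InLambdaClass p f lam → δ₁ ∈ Set.Ioo (0:ℝ) (1/2) → δ₂ ∈ Set.Ioo (0:ℝ) (1/2) →
      (derivMajorant p β₁ β₂ r₁ r₂ 2 δ₁ δ₂ f ≠ ⊤ →
        ∃ g : ℝ → ℝ → ℝ, HasWeylDeriv p r₁ r₂ f g) ∧
      (∀ g : ℝ → ℝ → ℝ, HasWeylDeriv p r₁ r₂ f g →
        mixedMod p β₁ β₂ δ₁ δ₂ g ≤
            ENNReal.ofReal C * derivMajorant p β₁ β₂ r₁ r₂ 2 δ₁ δ₂ f ∧
        derivMajorant p β₁ β₂ r₁ r₂ 2 δ₁ δ₂ f ≤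
            ENNReal.ofReal C * mixedMod p β₁ β₂ δ₁ δ₂ g) := by
  obtain ⟨C, hC, H⟩ := exists_mixedMod_weylDeriv_bounds hp hβ₁ hβ₂ hr₁ hr₂
  obtain ⟨A, hA, HA⟩ := exists_derivMajorant_bounds hp hβ₁ hβ₂ hr₁ hr₂
  refine ⟨C, hC, fun f lam δ₁ δ₂ hf hδ₁ hδ₂ => ?_⟩
  have hfi := hf.1.periodicIntegrable hp.le
  have hsupp : ∀ k ∉ dyadicFreq, coef2 (toPlane f) k = 0 := fun k hk =>
    hf.coef2_eq_zero hp.le hk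
  refine ⟨fun hfin => ?_, fun g hg => H f g hfi hsupp hg δ₁ δ₂ hδ₁.1 hδ₂.1⟩
  refine exists_hasWeylDeriv hp.le hβ₁ hβ₂ hr₁ hr₂ hδ₁.1 hδ₂.1 hfi hsupp ?_
  exact ne_top_of_le_ne_top (ENNReal.mul_ne_top ENNReal.ofReal_ne_top (ENNReal.pow_ne_top hfin))
    (HA f hfi hsupp δ₁ δ₂ hδ₁.1 hδ₂.1).2

end
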